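/- Let Ω ⊂ ℂ be a bounded hyperbolic domain. If Ω is Gromov hyperbolic (equivalently with respect to the hyperbolic metric h_Ω or the quasihyperbolic metric k_Ω), then Ω is an H-visibility domain if and only if Ω is a QH-visibility domain. -/

import Mathlib

open Metric Set Filter Topology MeasureTheory
open scoped NNReal ENNReal

noncomputable section

variable {E : Type*} [NormedAddCommGroup E] [NormedSpace ℝ E]

/-- The quasihyperbolic length of a path `γ : [a, b] → Ω`, i.e. `∫ ‖γ'(t)‖ / δ_Ω(γ t) dt`. -/
def qhLength (Ω : Set E) (γ : ℝ → E) (a b : ℝ) : ℝ :=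
  ∫ t in a..b, ‖deriv γ t‖ / infDist (γ t) Ωᶜ

/-- Admissible (Lipschitz, i.e. rectifiable) paths joining `x` to `y` inside `Ω`. -/
def qhAdmissible (Ω : Set E) (x y : E) (γ : ℝ → E) (a b : ℝ) : Prop :=
  a ≤ b ∧ γ a = x ∧ γ b = y ∧ (∀ t ∈ Icc a b, γ t ∈ Ω) ∧
    ∃ K : ℝ≥0, LipschitzOnWith K γ (Icc a b)

/-- The quasihyperbolic distance `k_Ω` on a domain `Ω`. -/
def qhDist (Ω : Set E) (x y : E) : ℝ :=
  sInf { L : ℝ | ∃ γ a b, qhAdmissible Ω x y γ a b ∧ L = qhLength Ω γ a b }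

/-- `γ` is a (unit-speed) quasihyperbolic geodesic on the parameter set `s`. -/
def IsQHGeodesicOn (Ω : Set E) (γ : ℝ → E) (s : Set ℝ) : Prop :=
  (∀ t ∈ s, γ t ∈ Ω) ∧ ∀ a ∈ s, ∀ b ∈ s, qhDist Ω (γ a) (γ b) = |a - b|

/-- `Ω` is a QH-visibility domain: any two distinct Euclidean boundary points have
neighbourhoods with disjoint closures together with a compact subset of `Ω` which is met by
every quasihyperbolic geodesic joining the two neighbourhoods. -/
def QHVisibilityDomain (Ω : Set E) : Prop :=
  ∀ p ∈ frontier Ω, ∀ q ∈ frontier Ω, p ≠ q →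
    ∃ U V : Set E, IsOpen U ∧ IsOpen V ∧ p ∈ U ∧ q ∈ V ∧
      closure U ∩ closure V = ∅ ∧
      ∃ K : Set E, IsCompact K ∧ K ⊆ Ω ∧
        ∀ (γ : ℝ → E) (T : ℝ), 0 ≤ T → IsQHGeodesicOn Ω γ (Icc 0 T) →
          γ 0 ∈ U → γ T ∈ V → ∃ t ∈ Icc 0 T, γ t ∈ K

/-- The Gromov product with respect to the quasihyperbolic distance. -/
def qhGromovProd (Ω : Set E) (o x y : E) : ℝ :=
  (qhDist Ω x o + qhDist Ω o y - qhDist Ω x y) / 2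

/-- `(Ω, k_Ω)` is Gromov hyperbolic (four-point condition on the Gromov product). -/
def QHGromovHyperbolic (Ω : Set E) : Prop :=
  ∃ δ : ℝ, 0 ≤ δ ∧ ∀ o ∈ Ω, ∀ x ∈ Ω, ∀ y ∈ Ω, ∀ z ∈ Ω,
    min (qhGromovProd Ω o x y) (qhGromovProd Ω o y z) - δ ≤ qhGromovProd Ω o x z

/-- `Ω ⊊ ℂ` is a hyperbolic domain: its complement contains at least two points. -/
def IsHyperbolicDomain (Ω : Set ℂ) : Prop :=
  ∃ a b : ℂ, a ≠ b ∧ a ∉ Ω ∧ b ∉ Ω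

/-- The hyperbolic density of `Ω` at `w` (curvature `-4` normalization), characterized via
Schwarz–Pick: the reciprocal of the largest derivative at `0` of a holomorphic map of the
unit disk into `Ω` sending `0` to `w`. -/
def hypDensity (Ω : Set ℂ) (w : ℂ) : ℝ :=
  1 / sSup { r : ℝ | ∃ f : ℂ → ℂ, DifferentiableOn ℂ f (ball (0 : ℂ) 1) ∧
      MapsTo f (ball (0 : ℂ) 1) Ω ∧ f 0 = w ∧ r = ‖deriv f 0‖ }

/-- The hyperbolic length of a path in `Ω`. -/
def hypLength (Ω : Set ℂ) (γ : ℝ → ℂ) (a b : ℝ) : ℝ :=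
  ∫ t in a..b, hypDensity Ω (γ t) * ‖deriv γ t‖

/-- The hyperbolic distance `h_Ω` on a hyperbolic domain `Ω ⊆ ℂ`. -/
def hypDist (Ω : Set ℂ) (x y : ℂ) : ℝ :=
  sInf { L : ℝ | ∃ γ a b, qhAdmissible Ω x y γ a b ∧ L = hypLength Ω γ a b }

/-- `γ` is a (unit-speed) hyperbolic geodesic on the parameter set `s`. -/
def IsHypGeodesicOn (Ω : Set ℂ) (γ : ℝ → ℂ) (s : Set ℝ) : Prop :=
  (∀ t ∈ s, γ t ∈ Ω) ∧ ∀ a ∈ s, ∀ b ∈ s, hypDist Ω (γ a) (γ b) = |a - b|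

/-- `Ω` is an H-visibility domain (visibility with respect to the hyperbolic metric). -/
def HVisibilityDomain (Ω : Set ℂ) : Prop :=
  ∀ p ∈ frontier Ω, ∀ q ∈ frontier Ω, p ≠ q →
    ∃ U V : Set ℂ, IsOpen U ∧ IsOpen V ∧ p ∈ U ∧ q ∈ V ∧
      closure U ∩ closure V = ∅ ∧
      ∃ K : Set ℂ, IsCompact K ∧ K ⊆ Ω ∧
        ∀ (γ : ℝ → ℂ) (T : ℝ), 0 ≤ T → IsHypGeodesicOn Ω γ (Icc 0 T) →
          γ 0 ∈ U → γ T ∈ V → ∃ t ∈ Icc 0 T, γ t ∈ K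

/-- A nonvanishing holomorphic function on a ball has a holomorphic logarithm with prescribed
value at the centre. -/
theorem exists_holomorphic_log_on_ball {g : ℂ → ℂ} {c : ℂ} {r : ℝ} {w : ℂ} (hr : 0 < r)
    (hg : DifferentiableOn ℂ g (ball c r)) (h0 : ∀ z ∈ ball c r, g z ≠ 0)
    (hw : Complex.exp w = g c) :
    ∃ L : ℂ → ℂ, DifferentiableOn ℂ L (ball c r) ∧ L c = w ∧
      ∀ z ∈ ball c r, Complex.exp (L z) = g z := by
  have hd : DifferentiableOn ℂ (fun z => deriv g z / g z) (ball c r) :=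
    (hg.deriv isOpen_ball).div hg h0
  obtain ⟨L, hL, hL'⟩ := hd.isExactOn_ball.with_val_at c w
  refine ⟨L, fun z hz => (hL' z hz).differentiableAt.differentiableWithinAt, hL, ?_⟩
  have hga : ∀ z ∈ ball c r, HasDerivAt g (deriv g z) z := fun z hz =>
    (hg.differentiableAt (isOpen_ball.mem_nhds hz)).hasDerivAt
  have hq : ∀ z ∈ ball c r, HasDerivAt (fun z => g z * Complex.exp (-L z)) 0 z := by
    intro z hz
    have h := (hga z hz).mul ((hL' z hz).neg.cexp)
    have h1 := div_mul_cancel₀ (deriv g z) (h0 z hz)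
    refine h.congr_deriv ?_
    linear_combination -Complex.exp (-L z) * h1
  have hconst : ∀ z ∈ ball c r, g z * Complex.exp (-L z) = g c * Complex.exp (-L c) := by
    intro z hz
    exact isOpen_ball.is_const_of_deriv_eq_zero (convex_ball c r).isPreconnected
      (fun z hz => (hq z hz).differentiableAt.differentiableWithinAt)
      (fun z hz => (hq z hz).deriv) hz (mem_ball_self hr)
  intro z hz
  have h := hconst z hz
  rw [hL, ← hw, ← Complex.exp_add, add_neg_cancel, Complex.exp_zero] at h
  have h2 : Complex.exp (L z) * (g z * Complex.exp (-L z)) = g z := by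
    rw [mul_left_comm, ← Complex.exp_add, add_neg_cancel, Complex.exp_zero, mul_one]
  rw [h, mul_one] at h2
  exact h2

/-- A holomorphic function whose derivative is at most doubled on a ball covers a
definite ball. -/
theorem ball_subset_image_of_deriv_le_two_mul {G : ℂ → ℂ} {z₀ : ℂ} {t : ℝ} (ht : 0 < t)
    (hG : DifferentiableOn ℂ G (ball z₀ t)) (hA : deriv G z₀ ≠ 0)
    (hb : ∀ z ∈ ball z₀ t, ‖deriv G z‖ ≤ 2 * ‖deriv G z₀‖) :
    ball (G z₀) (‖deriv G z₀‖ * t / 24) ⊆ G '' closedBall z₀ (t / 6) := by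
  set A := ‖deriv G z₀‖ with hAdef
  have hApos : 0 < A := norm_pos_iff.2 hA
  have hsub : closedBall z₀ (t / 6) ⊆ ball z₀ t := closedBall_subset_ball (by linarith)
  have hmaps : MapsTo (deriv G) (ball z₀ t) (closedBall (deriv G z₀) (3 * A)) := by
    intro z hz
    rw [mem_closedBall, dist_eq_norm]
    have := norm_sub_le (deriv G z) (deriv G z₀)
    have := hb z hz
    linarith
  have hd : ∀ z ∈ closedBall z₀ (t / 6), ‖deriv G z - deriv G z₀‖ ≤ A / 2 := by
    intro z hz
    have h := Complex.dist_le_div_mul_dist_of_mapsTo_ball (hG.deriv isOpen_ball) hmaps (hsub hz)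
    rw [dist_eq_norm] at h
    refine h.trans ?_
    have hz' : dist z z₀ ≤ t / 6 := hz
    calc 3 * A / t * dist z z₀ ≤ 3 * A / t * (t / 6) := by gcongr
      _ = A / 2 := by field_simp; ring
  have hmv : ∀ z ∈ closedBall z₀ (t / 6),
      ‖(G z - deriv G z₀ * z) - (G z₀ - deriv G z₀ * z₀)‖ ≤ A / 2 * ‖z - z₀‖ := by
    intro z hz
    refine (convex_closedBall z₀ (t / 6)).norm_image_sub_le_of_norm_hasDerivWithin_le
      (f := fun z => G z - deriv G z₀ * z) (f' := fun z => deriv G z - deriv G z₀ * 1)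
      (fun x hx => ?_) (fun x hx => ?_) (mem_closedBall_self (by positivity)) hz
    · have h1 : HasDerivAt G (deriv G x) x :=
        (hG.differentiableAt (isOpen_ball.mem_nhds (hsub hx))).hasDerivAt
      exact (h1.sub ((hasDerivAt_id x).const_mul _)).hasDerivWithinAt
    · simpa using hd x hx
  have hdiff : DiffContOnCl ℂ G (ball z₀ (t / 6)) :=
    ⟨hG.mono (ball_subset_closedBall.trans hsub),
      hG.continuousOn.mono (closure_ball_subset_closedBall.trans hsub)⟩
  have hz₀ : ∃ᶠ z in 𝓝 z₀, G z ≠ G z₀ := by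
    have h1 : HasDerivAt G (deriv G z₀) z₀ :=
      (hG.differentiableAt (isOpen_ball.mem_nhds (mem_ball_self ht))).hasDerivAt
    have h2 := h1.eventually_ne hA (c := G z₀)
    exact (h2.frequently).filter_mono nhdsWithin_le_nhds
  have hkey := hdiff.ball_subset_image_closedBall (ε := A * t / 12) (by positivity) ?_ hz₀
  · convert hkey using 2
    ring
  · intro z hz
    have hz' : ‖z - z₀‖ = t / 6 := by simpa [dist_eq_norm] using hz
    have h1 := hmv z (sphere_subset_closedBall hz)
    have h2 : ‖deriv G z₀ * (z - z₀)‖ = A * (t / 6) := by rw [norm_mul, hz']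
    have h3 : deriv G z₀ * (z - z₀) =
      (G z - G z₀) - ((G z - deriv G z₀ * z) - (G z₀ - deriv G z₀ * z₀)) := by ring
    have h4 := norm_sub_le (G z - G z₀) ((G z - deriv G z₀ * z) - (G z₀ - deriv G z₀ * z₀))
    rw [← h3, h2] at h4
    rw [hz'] at h1
    linarith

/-- **Bloch's theorem** (with a non-optimal constant). -/
theorem norm_deriv_le_of_no_large_ball {G : ℂ → ℂ} {r : ℝ}
    (hG : DifferentiableOn ℂ G (ball 0 1)) (hr : ∀ w, ¬ ball w r ⊆ G '' ball 0 1) :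
    ‖deriv G 0‖ ≤ 96 * r := by
  by_cases hzero : deriv G 0 = 0
  · rcases le_or_gt 0 r with h | h
    · rw [hzero, norm_zero]; positivity
    · exact absurd (by rw [ball_eq_empty.2 h.le]; exact empty_subset _) (hr 0)
  have hsub : closedBall (0 : ℂ) (1 / 2) ⊆ ball 0 1 := closedBall_subset_ball (by norm_num)
  have hcont : ContinuousOn (fun z => (1 / 2 - ‖z‖) * ‖deriv G z‖) (closedBall 0 (1 / 2)) := by
    have h := ((hG.deriv isOpen_ball).continuousOn.mono hsub).norm
    exact (continuous_const.sub continuous_norm).continuousOn.mul h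
  obtain ⟨z₀, hz₀, hmax⟩ := (isCompact_closedBall (0 : ℂ) (1 / 2)).exists_isMaxOn
    ⟨0, mem_closedBall_self (by norm_num)⟩ hcont
  have h0 : 1 / 2 * ‖deriv G 0‖ ≤ (1 / 2 - ‖z₀‖) * ‖deriv G z₀‖ := by
    have := hmax (mem_closedBall_self (by norm_num) : (0 : ℂ) ∈ closedBall 0 (1 / 2))
    simpa using this
  have hpos : 0 < (1 / 2 - ‖z₀‖) * ‖deriv G z₀‖ :=
    lt_of_lt_of_le (mul_pos (by norm_num) (norm_pos_iff.2 hzero)) h0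
  have hz₀' : ‖z₀‖ ≤ 1 / 2 := by simpa using hz₀
  set t := (1 / 2 - ‖z₀‖) / 2 with ht
  have hne : deriv G z₀ ≠ 0 := by
    intro h; rw [h] at hpos; simp at hpos
  have htpos : 0 < t := by
    have h1 : 0 < 1 / 2 - ‖z₀‖ := by
      rcases (sub_nonneg.2 hz₀').lt_or_eq with h | h
      · exact h
      · rw [← h] at hpos; simp at hpos
    positivity
  have hball : ball z₀ t ⊆ closedBall 0 (1 / 2) := by
    intro z hz
    rw [mem_closedBall, dist_zero_right]
    have h1 : ‖z - z₀‖ < t := by simpa [dist_eq_norm] using hz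
    have h2 := norm_sub_norm_le z z₀
    linarith
  have hkey := ball_subset_image_of_deriv_le_two_mul htpos (hG.mono (hball.trans hsub)) hne ?_
  · have hlt : ‖deriv G z₀‖ * t / 24 < r := by
      by_contra! hcon
      refine hr (G z₀) ((ball_subset_ball hcon).trans (hkey.trans (image_mono ?_)))
      exact (closedBall_subset_ball (by linarith)).trans (hball.trans hsub)
    have : (1 / 2 - ‖z₀‖) = 2 * t := by rw [ht]; ring
    rw [this] at h0
    linarith
  · intro z hz
    have h1 : (1 / 2 - ‖z‖) * ‖deriv G z‖ ≤ (1 / 2 - ‖z₀‖) * ‖deriv G z₀‖ := hmax (hball hz)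
    have h2 : ‖z - z₀‖ < t := by simpa [dist_eq_norm] using hz
    have h3 := norm_sub_norm_le z z₀
    have h4 : t ≤ 1 / 2 - ‖z‖ := by linarith
    have h5 : t * ‖deriv G z‖ ≤ t * (2 * ‖deriv G z₀‖) := by
      calc t * ‖deriv G z‖ ≤ (1 / 2 - ‖z‖) * ‖deriv G z‖ := by gcongr
        _ ≤ _ := h1
        _ = t * (2 * ‖deriv G z₀‖) := by rw [ht]; ring
    exact le_of_mul_le_mul_left h5 htpos

/-- Every point of the plane is close to a point where `cosh` is an odd integer. -/
theorem exists_cosh_eq_odd_near (w : ℂ) :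
    ∃ v : ℂ, ‖v - w‖ < 7 ∧ ∃ n : ℤ, Complex.cosh v = 2 * n - 1 := by
  have hx : ∃ x : ℝ, ‖x - |w.re|‖ ≤ 2 ∧ ∃ n : ℤ, Real.cosh x = 2 * n - 1 := by
    set u := |w.re| with hu
    have hu0 : 0 ≤ u := abs_nonneg _
    have hgap : Real.cosh u + 2 ≤ Real.cosh (u + 2) := by
      have h1 : 3 ≤ Real.cosh 2 := by
        have h := Real.cosh_sq' 1
        have h2 : (1 : ℝ) ≤ Real.sinh 1 := Real.self_le_sinh_iff.2 (by norm_num)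
        have h3 : Real.cosh (2 * 1) = Real.cosh 1 ^ 2 + Real.sinh 1 ^ 2 := Real.cosh_two_mul 1
        rw [mul_one] at h3
        nlinarith
      have h2 := Real.one_le_cosh u
      have h3 : 0 ≤ Real.sinh u * Real.sinh 2 :=
        mul_nonneg (Real.sinh_nonneg_iff.2 hu0) (Real.sinh_nonneg_iff.2 (by norm_num))
      rw [Real.cosh_add]
      nlinarith
    set n := ⌈(Real.cosh u + 1) / 2⌉ with hn
    have hn1 := Int.le_ceil ((Real.cosh u + 1) / 2)
    have hn2 := Int.ceil_lt_add_one ((Real.cosh u + 1) / 2)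
    have hmem : (2 * n - 1 : ℝ) ∈ Icc (Real.cosh u) (Real.cosh (u + 2)) := by
      constructor <;> linarith
    obtain ⟨x, hx, hxn⟩ := intermediate_value_Icc (by linarith : u ≤ u + 2)
      Real.continuous_cosh.continuousOn hmem
    refine ⟨x, ?_, n, hxn⟩
    rw [Real.norm_eq_abs, abs_le]
    constructor <;> linarith [hx.1, hx.2]
  obtain ⟨x, hx, n, hxn⟩ := hx
  obtain ⟨y, hy, hyc⟩ : ∃ y : ℝ, |y - w.re| ≤ 2 ∧ Real.cosh y = 2 * n - 1 := by
    rcases abs_cases w.re with ⟨h, -⟩ | ⟨h, -⟩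
    · exact ⟨x, by rwa [h] at hx, hxn⟩
    · refine ⟨-x, ?_, by rwa [Real.cosh_neg]⟩
      rw [h, Real.norm_eq_abs] at hx
      rw [← abs_neg]
      convert hx using 2
      ring
  set m := ⌊w.im / Real.pi⌋ with hm
  have hpi := Real.pi_pos
  have hm1 : m * Real.pi ≤ w.im := by
    have := Int.floor_le (w.im / Real.pi)
    rwa [le_div_iff₀ hpi] at this
  have hm2 : w.im < m * Real.pi + Real.pi := by
    have := Int.lt_floor_add_one (w.im / Real.pi)
    rw [div_lt_iff₀ hpi] at this
    linarith
  refine ⟨(y : ℂ) + (m * Real.pi : ℝ) * Complex.I, ?_, ?_⟩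
  · refine (Complex.norm_le_abs_re_add_abs_im _).trans_lt ?_
    have h1 : ((y : ℂ) + (m * Real.pi : ℝ) * Complex.I - w).re = y - w.re := by simp
    have h2 : ((y : ℂ) + (m * Real.pi : ℝ) * Complex.I - w).im = m * Real.pi - w.im := by simp
    rw [h1, h2]
    have h3 : |m * Real.pi - w.im| ≤ Real.pi := abs_le.2 ⟨by linarith, by linarith⟩
    have := Real.pi_lt_four
    linarith
  · have hs : Complex.sin ((m * Real.pi : ℝ) : ℂ) = 0 := by
      rw [← Complex.ofReal_sin, Real.sin_int_mul_pi, Complex.ofReal_zero]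
    rw [Complex.cosh_add, Complex.cosh_mul_I, Complex.sinh_mul_I, hs, ← Complex.ofReal_cosh, hyc,
      ← Complex.ofReal_cos, Real.cos_int_mul_pi]
    rcases neg_one_pow_eq_or ℝ m.natAbs with h | h
    · have hz : ((-1 : ℝ)) ^ m = 1 := by
        rcases Int.even_or_odd m with he | ho
        · exact he.neg_one_zpow
        · exact absurd h (by rw [(Int.natAbs_odd.2 ho).neg_one_pow]; norm_num)
      refine ⟨n, ?_⟩
      rw [hz]; push_cast; ring
    · have hz : ((-1 : ℝ)) ^ m = -1 := by
        rcases Int.even_or_odd m with he | ho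
        · exact absurd h (by rw [(Int.natAbs_even.2 he).neg_one_pow]; norm_num)
        · exact ho.neg_one_zpow
      refine ⟨1 - n, ?_⟩
      rw [hz]; push_cast; ring

/-- A holomorphic function on the disk omitting the integers has controlled derivative. -/
theorem norm_deriv_le_of_omits_int {F : ℂ → ℂ} (hF : DifferentiableOn ℂ F (ball 0 1))
    (hZ : ∀ z ∈ ball (0 : ℂ) 1, ∀ n : ℤ, F z ≠ n) :
    ‖deriv F 0‖ ≤ 672 * (1 + ‖F 0‖) := by
  have hmem0 : (0 : ℂ) ∈ ball (0 : ℂ) 1 := mem_ball_self one_pos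
  have hne0 : ∀ z ∈ ball (0 : ℂ) 1, F z ≠ 0 := fun z hz => by simpa using hZ z hz 0
  have hne1 : ∀ z ∈ ball (0 : ℂ) 1, F z - 1 ≠ 0 := fun z hz =>
    sub_ne_zero.2 (by simpa using hZ z hz 1)
  have hP : DifferentiableOn ℂ (fun z => F z * (F z - 1)) (ball 0 1) :=
    hF.mul (hF.sub_const 1)
  obtain ⟨P, hPd, -, hPe⟩ := exists_holomorphic_log_on_ball one_pos hP
    (fun z hz => mul_ne_zero (hne0 z hz) (hne1 z hz))
    (Complex.exp_log (mul_ne_zero (hne0 0 hmem0) (hne1 0 hmem0)))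
  set Q : ℂ → ℂ := fun z => 2 * F z - 1 + 2 * Complex.exp (P z / 2) with hQ
  have hQd : DifferentiableOn ℂ Q (ball 0 1) :=
    ((hF.const_mul 2).sub_const 1).add ((hPd.div_const 2).cexp.const_mul 2)
  have hsq : ∀ z ∈ ball (0 : ℂ) 1, Complex.exp (P z / 2) ^ 2 = F z * (F z - 1) := by
    intro z hz
    rw [← Complex.exp_nat_mul, ← hPe z hz]
    congr 1
    push_cast
    ring
  have hQmul : ∀ z ∈ ball (0 : ℂ) 1, Q z * (2 * F z - 1 - 2 * Complex.exp (P z / 2)) = 1 := by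
    intro z hz
    have := hsq z hz
    simp only [hQ]
    linear_combination (-4) * this
  have hQne : ∀ z ∈ ball (0 : ℂ) 1, Q z ≠ 0 := fun z hz h => by
    have := hQmul z hz
    rw [h, zero_mul] at this
    exact zero_ne_one this
  obtain ⟨G, hGd, -, hGe⟩ := exists_holomorphic_log_on_ball one_pos hQd hQne
    (Complex.exp_log (hQne 0 hmem0))
  have hcosh : ∀ z ∈ ball (0 : ℂ) 1, Complex.cosh (G z) = 2 * F z - 1 := by
    intro z hz
    rw [Complex.cosh, Complex.exp_neg, hGe z hz, inv_eq_of_mul_eq_one_right (hQmul z hz)]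
    simp only [hQ]
    ring
  have hbloch : ‖deriv G 0‖ ≤ 96 * 7 := by
    refine norm_deriv_le_of_no_large_ball hGd fun w hsub => ?_
    obtain ⟨v, hv, n, hn⟩ := exists_cosh_eq_odd_near w
    obtain ⟨z, hz, hzv⟩ := hsub (by rwa [mem_ball, dist_eq_norm] : v ∈ ball w 7)
    refine hZ z hz n ?_
    have h := hcosh z hz
    rw [hzv, hn] at h
    linear_combination (-1 / 2) * h
  have hGat : HasDerivAt G (deriv G 0) 0 :=
    (hGd.differentiableAt (isOpen_ball.mem_nhds hmem0)).hasDerivAt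
  have hFat : HasDerivAt F (deriv F 0) 0 :=
    (hF.differentiableAt (isOpen_ball.mem_nhds hmem0)).hasDerivAt
  have hderiv : 2 * deriv F 0 = Complex.sinh (G 0) * deriv G 0 := by
    have h1 : HasDerivAt (fun z => 2 * F z - 1) (2 * deriv F 0) 0 :=
      (hFat.const_mul 2).sub_const 1
    have h2 := hGat.ccosh
    refine h1.unique (h2.congr_of_eventuallyEq ?_)
    filter_upwards [isOpen_ball.mem_nhds hmem0] with z hz using (hcosh z hz).symm
  have hsinh : ‖Complex.sinh (G 0)‖ ≤ 2 * (1 + ‖F 0‖) := by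
    have h1 := Complex.cosh_sq (G 0)
    rw [hcosh 0 hmem0] at h1
    have h2 : Complex.sinh (G 0) ^ 2 = 4 * (F 0 * (F 0 - 1)) := by linear_combination -h1
    have h3 : ‖Complex.sinh (G 0)‖ ^ 2 = 4 * (‖F 0‖ * ‖F 0 - 1‖) := by
      rw [← norm_pow, h2]; simp
    have h4 : ‖F 0 - 1‖ ≤ ‖F 0‖ + 1 := by simpa using norm_sub_le (F 0) 1
    have h5 := norm_nonneg (F 0)
    refine le_of_sq_le_sq ?_ (by positivity)
    rw [h3]
    nlinarith [mul_le_mul_of_nonneg_left h4 h5]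
  have hfin : 2 * ‖deriv F 0‖ ≤ 2 * (1 + ‖F 0‖) * (96 * 7) := by
    calc 2 * ‖deriv F 0‖ = ‖2 * deriv F 0‖ := by simp
      _ = ‖Complex.sinh (G 0)‖ * ‖deriv G 0‖ := by rw [hderiv, norm_mul]
      _ ≤ _ := by gcongr
  linarith

/-- **Landau's theorem**: the derivative at the centre of a holomorphic function on the disk
omitting two values `a` and `b`. -/
theorem norm_deriv_le_of_omits_pair {f : ℂ → ℂ} {a b : ℂ} (hab : a ≠ b)
    (hf : DifferentiableOn ℂ f (ball 0 1)) (ha : ∀ z ∈ ball (0 : ℂ) 1, f z ≠ a)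
    (hb : ∀ z ∈ ball (0 : ℂ) 1, f z ≠ b) :
    ‖deriv f 0‖ ≤ 10000 * (‖f 0 - a‖ * (1 + |Real.log (‖f 0 - a‖ / ‖b - a‖)|)) := by
  have hmem0 : (0 : ℂ) ∈ ball (0 : ℂ) 1 := mem_ball_self one_pos
  have hba : b - a ≠ 0 := sub_ne_zero.2 hab.symm
  set g : ℂ → ℂ := fun z => (f z - a) / (b - a) with hg
  have hgd : DifferentiableOn ℂ g (ball 0 1) := (hf.sub_const a).div_const _
  have hg0 : ∀ z ∈ ball (0 : ℂ) 1, g z ≠ 0 := fun z hz =>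
    div_ne_zero (sub_ne_zero.2 (ha z hz)) hba
  obtain ⟨L, hLd, hL0, hLe⟩ := exists_holomorphic_log_on_ball one_pos hgd hg0
    (Complex.exp_log (hg0 0 hmem0))
  set F : ℂ → ℂ := fun z => L z / (2 * Real.pi * Complex.I) with hF
  have hpi := Real.pi_pos
  have hpc : (2 * Real.pi * Complex.I : ℂ) ≠ 0 := Complex.two_pi_I_ne_zero
  have hnpi : ‖(2 * Real.pi * Complex.I : ℂ)‖ = 2 * Real.pi := by
    simp [abs_of_pos hpi]
  have hFd : DifferentiableOn ℂ F (ball 0 1) := hLd.div_const _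
  have hkey := norm_deriv_le_of_omits_int hFd fun z hz n hn => by
    have h1 : L z = n * (2 * Real.pi * Complex.I) := by
      simp only [hF] at hn
      rwa [div_eq_iff hpc] at hn
    have h2 := hLe z hz
    rw [h1, Complex.exp_int_mul_two_pi_mul_I] at h2
    simp only [hg] at h2
    rw [eq_comm, div_eq_iff hba, one_mul, sub_left_inj] at h2
    exact hb z hz h2
  have hLat : HasDerivAt L (deriv L 0) 0 :=
    (hLd.differentiableAt (isOpen_ball.mem_nhds hmem0)).hasDerivAt
  have hfat : HasDerivAt f (deriv f 0) 0 :=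
    (hf.differentiableAt (isOpen_ball.mem_nhds hmem0)).hasDerivAt
  have hFderiv : deriv F 0 = deriv L 0 / (2 * Real.pi * Complex.I) :=
    (hLat.div_const _).deriv
  have hfL : deriv f 0 / (b - a) = g 0 * deriv L 0 := by
    have h1 : HasDerivAt g (deriv f 0 / (b - a)) 0 := (hfat.sub_const a).div_const _
    have h2 := hLat.cexp
    rw [hLe 0 hmem0] at h2
    refine h1.unique (h2.congr_of_eventuallyEq ?_)
    filter_upwards [isOpen_ball.mem_nhds hmem0] with z hz using (hLe z hz).symm
  have hfF : deriv f 0 = (f 0 - a) * (deriv F 0 * (2 * Real.pi * Complex.I)) := by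
    rw [hFderiv, div_mul_cancel₀ _ hpc]
    rw [div_eq_iff hba] at hfL
    rw [hfL]
    simp only [hg]
    field_simp
  have hnL : ‖L 0‖ ≤ |Real.log (‖f 0 - a‖ / ‖b - a‖)| + Real.pi := by
    rw [hL0]
    refine (Complex.norm_le_abs_re_add_abs_im _).trans ?_
    rw [Complex.log_re, Complex.log_im]
    simp only [hg, norm_div]
    gcongr
    exact Complex.abs_arg_le_pi _
  set l := |Real.log (‖f 0 - a‖ / ‖b - a‖)| with hl
  have hl0 : 0 ≤ l := abs_nonneg _
  have hnF : ‖F 0‖ * (2 * Real.pi) ≤ l + Real.pi := by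
    have : ‖F 0‖ * (2 * Real.pi) = ‖L 0‖ := by
      simp only [hF]
      rw [norm_div, hnpi, div_mul_cancel₀ _ (by positivity)]
    rw [this]
    exact hnL
  have hpi4 := Real.pi_lt_d2
  calc ‖deriv f 0‖ = ‖f 0 - a‖ * (‖deriv F 0‖ * (2 * Real.pi)) := by
        rw [hfF, norm_mul, norm_mul, hnpi]
    _ ≤ ‖f 0 - a‖ * (10000 * (1 + l)) := by
        refine mul_le_mul_of_nonneg_left ?_ (norm_nonneg _)
        have : ‖deriv F 0‖ * (2 * Real.pi) ≤ 672 * (1 + ‖F 0‖) * (2 * Real.pi) := by gcongr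
        nlinarith
    _ = _ := by ring

/-- The length of a path with respect to the conformal weight `ρ`. -/
def weightedLength (ρ : ℂ → ℝ) (γ : ℝ → ℂ) (a b : ℝ) : ℝ :=
  ∫ t in a..b, ρ (γ t) * ‖deriv γ t‖

/-- The distance on `Ω` induced by the conformal weight `ρ`. -/
def weightedDist (Ω : Set ℂ) (ρ : ℂ → ℝ) (x y : ℂ) : ℝ :=
  sInf { L : ℝ | ∃ γ a b, qhAdmissible Ω x y γ a b ∧ L = weightedLength ρ γ a b }

/-- A measurable nonnegative weight which is bounded on compact subsets of `Ω`. -/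
structure IsConformalWeight (Ω : Set ℂ) (ρ : ℂ → ℝ) : Prop where
  measurable : Measurable ρ
  nonneg : ∀ z, 0 ≤ ρ z
  bounded : ∀ K ⊆ Ω, IsCompact K → ∃ M, ∀ z ∈ K, ρ z ≤ M

section Paths

variable {Ω : Set ℂ} {ρ : ℂ → ℝ} {x y z : ℂ} {γ : ℝ → ℂ} {a b : ℝ}

theorem qhAdmissible.continuousOn (h : qhAdmissible Ω x y γ a b) : ContinuousOn γ (Icc a b) :=
  h.2.2.2.2.choose_spec.continuousOn

theorem qhAdmissible.restrict (h : qhAdmissible Ω x y γ a b) {s t : ℝ} (hs : a ≤ s) (hst : s ≤ t)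
    (ht : t ≤ b) : qhAdmissible Ω (γ s) (γ t) γ s t := by
  obtain ⟨-, -, -, hΩ, K, hK⟩ := h
  exact ⟨hst, rfl, rfl, fun u hu => hΩ u (Icc_subset_Icc hs ht hu),
    K, hK.mono (Icc_subset_Icc hs ht)⟩

theorem qhAdmissible.exists_integrand_le (hρ : IsConformalWeight Ω ρ)
    (h : qhAdmissible Ω x y γ a b) :
    ∃ M : ℝ, 0 ≤ M ∧ ∀ t ∈ Ioo a b, ρ (γ t) * ‖deriv γ t‖ ≤ M := by
  obtain ⟨-, -, -, hΩ, K, hK⟩ := id h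
  obtain ⟨M, hM⟩ := hρ.bounded (γ '' Icc a b) (image_subset_iff.2 hΩ)
    (isCompact_Icc.image_of_continuousOn h.continuousOn)
  refine ⟨max M 0 * K, by positivity, fun t ht => ?_⟩
  have h1 : ‖deriv γ t‖ ≤ K := norm_deriv_le_of_lipschitzOn (Icc_mem_nhds ht.1 ht.2) hK
  have h2 : ρ (γ t) ≤ max M 0 :=
    (hM _ (mem_image_of_mem γ (Ioo_subset_Icc_self ht))).trans (le_max_left _ _)
  gcongr

theorem qhAdmissible.intervalIntegrable (hρ : IsConformalWeight Ω ρ)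
    (h : qhAdmissible Ω x y γ a b) :
    IntervalIntegrable (fun t => ρ (γ t) * ‖deriv γ t‖) volume a b := by
  obtain ⟨M, hM0, hM⟩ := h.exists_integrand_le hρ
  rw [intervalIntegrable_iff_integrableOn_Ioo_of_le h.1]
  have hmeas : AEStronglyMeasurable (fun t => ρ (γ t) * ‖deriv γ t‖)
      (volume.restrict (Ioo a b)) := by
    have h1 : AEMeasurable γ (volume.restrict (Ioo a b)) :=
      (h.continuousOn.mono Ioo_subset_Icc_self).aemeasurable measurableSet_Ioo
    exact ((hρ.measurable.comp_aemeasurable h1).mul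
      (measurable_deriv γ).norm.aemeasurable).aestronglyMeasurable
  refine Integrable.mono' (g := fun _ => M) (integrable_const M) hmeas ?_
  refine (ae_restrict_iff' measurableSet_Ioo).2 (Eventually.of_forall fun t ht => ?_)
  rw [Real.norm_of_nonneg (mul_nonneg (hρ.nonneg _) (norm_nonneg _))]
  exact hM t ht

theorem weightedLength_nonneg (hρ : ∀ z, 0 ≤ ρ z) (hab : a ≤ b) : 0 ≤ weightedLength ρ γ a b :=
  intervalIntegral.integral_nonneg hab fun _ _ => mul_nonneg (hρ _) (norm_nonneg _)

theorem bddBelow_weightedLength (hρ : ∀ z, 0 ≤ ρ z) :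
    BddBelow { L : ℝ | ∃ γ a b, qhAdmissible Ω x y γ a b ∧ L = weightedLength ρ γ a b } :=
  ⟨0, by rintro _ ⟨γ, a, b, h, rfl⟩; exact weightedLength_nonneg hρ h.1⟩

theorem weightedDist_nonneg (hρ : ∀ z, 0 ≤ ρ z) : 0 ≤ weightedDist Ω ρ x y :=
  Real.sInf_nonneg (by rintro _ ⟨γ, a, b, h, rfl⟩; exact weightedLength_nonneg hρ h.1)

theorem qhAdmissible.weightedDist_le (hρ : ∀ z, 0 ≤ ρ z) (h : qhAdmissible Ω x y γ a b) :
    weightedDist Ω ρ x y ≤ weightedLength ρ γ a b :=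
  csInf_le (bddBelow_weightedLength hρ) ⟨γ, a, b, h, rfl⟩

theorem qhAdmissible_const (hx : x ∈ Ω) : qhAdmissible Ω x x (fun _ => x) 0 0 :=
  ⟨le_rfl, rfl, rfl, fun _ _ => hx, 0, (LipschitzWith.const x).lipschitzOnWith⟩

theorem weightedDist_self (hρ : ∀ z, 0 ≤ ρ z) (hx : x ∈ Ω) : weightedDist Ω ρ x x = 0 := by
  refine le_antisymm ?_ (weightedDist_nonneg hρ)
  simpa [weightedLength] using (qhAdmissible_const hx).weightedDist_le hρ

theorem qhAdmissible.reverse (h : qhAdmissible Ω x y γ a b) :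
    qhAdmissible Ω y x (fun t => γ (-t)) (-b) (-a) := by
  obtain ⟨hab, ha, hb, hΩ, K, hK⟩ := h
  have hmem : ∀ t ∈ Icc (-b) (-a), -t ∈ Icc a b := fun t ht =>
    ⟨by linarith [ht.2], by linarith [ht.1]⟩
  refine ⟨neg_le_neg hab, by simpa using hb, by simpa using ha, fun t ht => hΩ _ (hmem t ht), K,
    LipschitzOnWith.of_dist_le_mul fun s hs t ht => ?_⟩
  simpa using hK.dist_le_mul _ (hmem s hs) _ (hmem t ht)

theorem weightedLength_reverse :
    weightedLength ρ (fun t => γ (-t)) (-b) (-a) = weightedLength ρ γ a b := by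
  unfold weightedLength
  have h : ∀ t, deriv (fun t => γ (-t)) t = -deriv γ (-t) := fun t => deriv_comp_neg γ t
  simp only [h, norm_neg]
  rw [intervalIntegral.integral_comp_neg (fun t => ρ (γ t) * ‖deriv γ t‖)]
  simp

theorem weightedDist_comm : weightedDist Ω ρ x y = weightedDist Ω ρ y x := by
  unfold weightedDist
  congr 1
  ext L
  constructor <;> rintro ⟨γ, a, b, h, rfl⟩ <;>
    exact ⟨_, _, _, h.reverse, weightedLength_reverse.symm⟩

theorem qhAdmissible.shift (h : qhAdmissible Ω x y γ a b) (c : ℝ) :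
    qhAdmissible Ω x y (fun t => γ (t + c)) (a - c) (b - c) := by
  obtain ⟨hab, ha, hb, hΩ, K, hK⟩ := h
  have hmem : ∀ t ∈ Icc (a - c) (b - c), t + c ∈ Icc a b := fun t ht =>
    ⟨by linarith [ht.1], by linarith [ht.2]⟩
  refine ⟨by linarith, by simpa using ha, by simpa using hb, fun t ht => hΩ _ (hmem t ht), K,
    LipschitzOnWith.of_dist_le_mul fun s hs t ht => ?_⟩
  simpa using hK.dist_le_mul _ (hmem s hs) _ (hmem t ht)

theorem weightedLength_shift (c : ℝ) :
    weightedLength ρ (fun t => γ (t + c)) (a - c) (b - c) = weightedLength ρ γ a b := by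
  unfold weightedLength
  have h : ∀ t, deriv (fun t => γ (t + c)) t = deriv γ (t + c) :=
    fun t => deriv_comp_add_const γ c t
  simp only [h]
  rw [intervalIntegral.integral_comp_add_right (fun t => ρ (γ t) * ‖deriv γ t‖)]
  simp

theorem qhAdmissible.glue {η : ℝ → ℂ} {c : ℝ} (h : qhAdmissible Ω x y γ a b)
    (h' : qhAdmissible Ω y z η b c) :
    qhAdmissible Ω x z (fun t => if t ≤ b then γ t else η t) a c := by
  obtain ⟨hab, ha, hb, hΩ, K, hK⟩ := h
  obtain ⟨hbc, hb', hc, hΩ', K', hK'⟩ := h'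
  refine ⟨hab.trans hbc, by simpa [hab] using ha, ?_, fun t ht => ?_, max K K', ?_⟩
  · rcases hbc.eq_or_lt with rfl | hlt
    · simp [hb, ← hb', hc]
    · simp [not_le.2 hlt, hc]
  · by_cases htb : t ≤ b
    · simpa [htb] using hΩ t ⟨ht.1, htb⟩
    · simpa [htb] using hΩ' t ⟨(not_le.1 htb).le, ht.2⟩
  · have key : ∀ s ∈ Icc a c, ∀ t ∈ Icc a c, s ≤ t →
        dist (if s ≤ b then γ s else η s) (if t ≤ b then γ t else η t)
          ≤ (max K K' : ℝ≥0) * dist s t := by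
      intro s hs t ht hst
      have hl : (K : ℝ) ≤ (max K K' : ℝ≥0) := by exact_mod_cast le_max_left K K'
      have hr : (K' : ℝ) ≤ (max K K' : ℝ≥0) := by exact_mod_cast le_max_right K K'
      by_cases htb : t ≤ b
      · simp only [htb, hst.trans htb, if_true]
        exact (hK.dist_le_mul s ⟨hs.1, hst.trans htb⟩ t ⟨ht.1, htb⟩).trans (by gcongr)
      · have htb' := not_le.1 htb
        by_cases hsb : s ≤ b
        · simp only [htb, hsb, if_true, if_false]
          have h1 := hK.dist_le_mul s ⟨hs.1, hsb⟩ b ⟨hab, le_rfl⟩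
          have h2 := hK'.dist_le_mul b ⟨le_rfl, hbc⟩ t ⟨htb'.le, ht.2⟩
          rw [hb] at h1
          rw [hb'] at h2
          rw [Real.dist_eq, abs_sub_comm, abs_of_nonneg (by linarith)] at h1 h2 ⊢
          have h3 := dist_triangle (γ s) y (η t)
          nlinarith
        · simp only [htb, hsb, if_false]
          exact (hK'.dist_le_mul s ⟨(not_le.1 hsb).le, hs.2⟩ t ⟨htb'.le, ht.2⟩).trans (by gcongr)
    refine LipschitzOnWith.of_dist_le_mul fun s hs t ht => ?_
    rcases le_total s t with hst | hst
    · exact key s hs t ht hst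
    · rw [dist_comm, dist_comm s]
      exact key t ht s hs hst

theorem weightedLength_glue {η : ℝ → ℂ} {c : ℝ} (hρ : IsConformalWeight Ω ρ)
    (h : qhAdmissible Ω x y γ a b) (h' : qhAdmissible Ω y z η b c) :
    weightedLength ρ (fun t => if t ≤ b then γ t else η t) a c =
      weightedLength ρ γ a b + weightedLength ρ η b c := by
  have hg := h.glue h'
  have hi1 := (hg.restrict le_rfl h.1 h'.1).intervalIntegrable hρ
  have hi2 := (hg.restrict h.1 h'.1 le_rfl).intervalIntegrable hρ
  unfold weightedLength
  rw [← intervalIntegral.integral_add_adjacent_intervals hi1 hi2]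
  congr 1
  · refine intervalIntegral.integral_congr_ae ?_
    filter_upwards [compl_mem_ae_iff.2 (measure_singleton b)] with t htb ht
    rw [uIoc_of_le h.1] at ht
    have hlt : t < b := lt_of_le_of_ne ht.2 htb
    have heq : (fun t => if t ≤ b then γ t else η t) =ᶠ[𝓝 t] γ := by
      filter_upwards [Iio_mem_nhds hlt] with s hs
      simp [(mem_Iio.1 hs).le]
    rw [heq.deriv_eq]
    simp [hlt.le]
  · refine intervalIntegral.integral_congr_ae (Eventually.of_forall fun t ht => ?_)
    rw [uIoc_of_le h'.1] at ht
    have heq : (fun t => if t ≤ b then γ t else η t) =ᶠ[𝓝 t] η := by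
      filter_upwards [Ioi_mem_nhds ht.1] with s hs
      simp [not_le.2 (mem_Ioi.1 hs)]
    rw [heq.deriv_eq]
    simp [not_le.2 ht.1]

theorem qhAdmissible.exists_trans {η : ℝ → ℂ} {c d : ℝ} (hρ : IsConformalWeight Ω ρ)
    (h : qhAdmissible Ω x y γ a b) (h' : qhAdmissible Ω y z η c d) :
    ∃ ζ e f, qhAdmissible Ω x z ζ e f ∧
      weightedLength ρ ζ e f = weightedLength ρ γ a b + weightedLength ρ η c d := by
  have h2 := h'.shift (c - b)
  rw [sub_sub_cancel] at h2
  refine ⟨_, _, _, h.glue h2, ?_⟩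
  rw [weightedLength_glue hρ h h2, ← weightedLength_shift (γ := η) (c - b), sub_sub_cancel]

theorem qhAdmissible_segment {r : ℝ} (hr : ball x r ⊆ Ω) (hy : y ∈ ball x r) :
    qhAdmissible Ω x y (AffineMap.lineMap x y) 0 1 := by
  have hrp : 0 < r := pos_of_mem_ball hy
  refine ⟨zero_le_one, by simp, by simp, fun t ht => hr ?_, _,
    (lipschitzWith_lineMap x y).lipschitzOnWith⟩
  exact (convex_ball x r).segment_subset (mem_ball_self hrp) hy
    (segment_eq_image_lineMap ℝ x y ▸ mem_image_of_mem _ ht)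

theorem weightedDist_le_mul_norm {r M : ℝ} (hρ : IsConformalWeight Ω ρ) (hr : ball x r ⊆ Ω)
    (hM : ∀ z ∈ ball x r, ρ z ≤ M) (hy : y ∈ ball x r) :
    weightedDist Ω ρ x y ≤ M * ‖y - x‖ := by
  have hadm := qhAdmissible_segment hr hy
  refine (hadm.weightedDist_le hρ.nonneg).trans ?_
  have h : weightedLength ρ (AffineMap.lineMap x y) 0 1 ≤ ∫ _ in (0 : ℝ)..1, M * ‖y - x‖ := by
    refine intervalIntegral.integral_mono_on zero_le_one (hadm.intervalIntegrable hρ)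
      intervalIntegrable_const fun t ht => ?_
    have h1 : deriv (AffineMap.lineMap x y : ℝ → ℂ) t = y - x :=
      AffineMap.hasDerivAt_lineMap.deriv
    rw [h1]
    gcongr
    refine hM _ ((convex_ball x r).segment_subset (mem_ball_self (pos_of_mem_ball hy)) hy ?_)
    exact segment_eq_image_lineMap ℝ x y ▸ mem_image_of_mem _ ht
  simpa using h

theorem exists_qhAdmissible (hO : IsOpen Ω) (hC : IsPreconnected Ω) (hx : x ∈ Ω) (hy : y ∈ Ω) :
    ∃ γ a b, qhAdmissible Ω x y γ a b := by
  have hw : IsConformalWeight Ω (fun _ => 0) :=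
    ⟨measurable_const, fun _ => le_rfl, fun _ _ _ => ⟨0, fun _ _ => le_rfl⟩⟩
  refine hC.induction₂ (fun x y => ∃ γ a b, qhAdmissible Ω x y γ a b) ?_ ?_ ?_ hx hy
  · intro x hx
    obtain ⟨r, hr, hsub⟩ := Metric.isOpen_iff.1 hO x hx
    filter_upwards [mem_nhdsWithin_of_mem_nhds (ball_mem_nhds x hr)] with y hy
    exact ⟨_, _, _, qhAdmissible_segment hsub hy⟩
  · rintro x y z - - - ⟨γ, a, b, h⟩ ⟨η, c, d, h'⟩
    obtain ⟨ζ, e, f, h'', -⟩ := h.exists_trans hw h'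
    exact ⟨ζ, e, f, h''⟩
  · rintro x y - - ⟨γ, a, b, h⟩
    exact ⟨_, _, _, h.reverse⟩

theorem exists_weightedLength_lt (hO : IsOpen Ω) (hC : IsPreconnected Ω) (hx : x ∈ Ω)
    (hy : y ∈ Ω) {L : ℝ} (hL : weightedDist Ω ρ x y < L) :
    ∃ γ a b, qhAdmissible Ω x y γ a b ∧ weightedLength ρ γ a b < L := by
  obtain ⟨γ, a, b, h⟩ := exists_qhAdmissible hO hC hx hy
  have hne : { L : ℝ | ∃ γ a b, qhAdmissible Ω x y γ a b ∧
      L = weightedLength ρ γ a b }.Nonempty := ⟨_, γ, a, b, h, rfl⟩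
  obtain ⟨_, ⟨γ, a, b, h, rfl⟩, hlt⟩ := exists_lt_of_csInf_lt hne hL
  exact ⟨γ, a, b, h, hlt⟩

theorem weightedDist_triangle (hρ : IsConformalWeight Ω ρ) (hO : IsOpen Ω)
    (hC : IsPreconnected Ω) (hx : x ∈ Ω) (hy : y ∈ Ω) (hz : z ∈ Ω) :
    weightedDist Ω ρ x z ≤ weightedDist Ω ρ x y + weightedDist Ω ρ y z := by
  refine le_of_forall_pos_le_add fun ε hε => ?_
  obtain ⟨γ, a, b, h, hl⟩ := exists_weightedLength_lt (ρ := ρ) hO hC hx hy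
    (lt_add_of_pos_right _ (half_pos hε))
  obtain ⟨η, c, d, h', hl'⟩ := exists_weightedLength_lt (ρ := ρ) hO hC hy hz
    (lt_add_of_pos_right _ (half_pos hε))
  obtain ⟨ζ, e, f, h'', hl''⟩ := h.exists_trans hρ h'
  have := h''.weightedDist_le hρ.nonneg
  linarith

theorem weightedLength_add (hρ : IsConformalWeight Ω ρ) (h : qhAdmissible Ω x y γ a b) {t : ℝ}
    (ht : t ∈ Icc a b) :
    weightedLength ρ γ a t + weightedLength ρ γ t b = weightedLength ρ γ a b :=
  intervalIntegral.integral_add_adjacent_intervals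
    ((h.restrict le_rfl ht.1 ht.2).intervalIntegrable hρ)
    ((h.restrict ht.1 ht.2 le_rfl).intervalIntegrable hρ)

/-- A Lipschitz function along a path whose upper derivative is dominated by `c t * ‖γ' t‖`
grows at most by the corresponding weighted length. -/
theorem sub_le_integral_of_local_le {γ : ℝ → ℂ} {G c : ℝ → ℝ} {a b : ℝ} {K K' : ℝ≥0}
    (hab : a ≤ b) (hγ : LipschitzOnWith K γ (Icc a b)) (hG : LipschitzOnWith K' G (Icc a b))
    (hc : ∀ t, 0 ≤ c t) (h_int : IntervalIntegrable (fun t => c t * ‖deriv γ t‖) volume a b)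
    (hloc : ∀ t ∈ Ioo a b, ∀ s ∈ Icc a b, G s - G t ≤ c t * ‖γ s - γ t‖) :
    G b - G a ≤ ∫ t in a..b, c t * ‖deriv γ t‖ := by
  rw [← uIcc_of_le hab] at hγ hG
  have hAC := hG.absolutelyContinuousOnInterval
  rw [← hAC.integral_deriv_eq_sub]
  have hd := hγ.absolutelyContinuousOnInterval.boundedVariationOn.ae_differentiableAt_of_mem_uIcc
  refine intervalIntegral.integral_mono_ae_restrict hab hAC.intervalIntegrable_deriv h_int ?_
  have hIoo : ∀ᵐ t ∂(volume.restrict (Icc a b)), t ∈ Ioo a b := by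
    rw [← restrict_Ioo_eq_restrict_Icc]
    exact ae_restrict_mem measurableSet_Ioo
  filter_upwards [ae_restrict_of_ae hd, hIoo] with t ht htI
  by_cases hGd : DifferentiableAt ℝ G t
  · have h1 := hGd.hasDerivAt.tendsto_slope.mono_left (nhdsGT_le_nhdsNE t)
    have hγd := (ht (by rw [uIcc_of_le hab]; exact Ioo_subset_Icc_self htI)).hasDerivAt
    have h2 := (hγd.tendsto_slope.mono_left (nhdsGT_le_nhdsNE t)).norm.const_mul (c t)
    refine le_of_tendsto_of_tendsto h1 h2 ?_
    filter_upwards [self_mem_nhdsWithin, mem_nhdsWithin_of_mem_nhds (Icc_mem_nhds htI.1 htI.2)]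
      with s hs hsI
    have hst : 0 < s - t := sub_pos.2 hs
    rw [slope_def_field, slope_def_module, norm_smul, norm_inv, Real.norm_of_nonneg hst.le,
      div_le_iff₀ hst]
    refine (hloc t htI s hsI).trans_eq ?_
    field_simp
  · rw [deriv_zero_of_not_differentiableAt hGd]
    exact mul_nonneg (hc t) (norm_nonneg _)

end Paths

section Weights

variable {Ω : Set ℂ} {x y z : ℂ}

theorem infDist_compl_pos (hO : IsOpen Ω) (hne : Ωᶜ.Nonempty) (hx : x ∈ Ω) :
    0 < infDist x Ωᶜ :=
  (hO.isClosed_compl.notMem_iff_infDist_pos hne).1 (not_not.2 hx)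

theorem infDist_compl_le (hz : z ∉ Ω) : infDist x Ωᶜ ≤ ‖x - z‖ := by
  rw [← dist_eq_norm]
  exact infDist_le_dist_of_mem hz

theorem isConformalWeight_inv_infDist (hO : IsOpen Ω) (hne : Ωᶜ.Nonempty) :
    IsConformalWeight Ω (fun z => 1 / infDist z Ωᶜ) := by
  refine ⟨measurable_const.div measurable_infDist,
    fun z => one_div_nonneg.2 infDist_nonneg, fun K hK hKc => ?_⟩
  have hc : ContinuousOn (fun z => 1 / infDist z Ωᶜ) K :=
    continuousOn_const.div (continuous_infDist_pt _).continuousOn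
      fun z hz => (infDist_compl_pos hO hne (hK hz)).ne'
  obtain ⟨M, hM⟩ := hKc.exists_bound_of_continuousOn hc
  exact ⟨M, fun z hz => (le_abs_self _).trans (hM z hz)⟩

theorem qhDist_eq_weightedDist :
    qhDist Ω x y = weightedDist Ω (fun z => 1 / infDist z Ωᶜ) x y := by
  have h : ∀ (γ : ℝ → ℂ) a b, qhLength Ω γ a b =
      weightedLength (fun z => 1 / infDist z Ωᶜ) γ a b := fun γ a b => by
    unfold qhLength weightedLength
    congr 1
    ext t
    ring
  unfold qhDist weightedDist
  simp only [h]

theorem log_sub_log_le_qhDist (hO : IsOpen Ω) (hC : IsPreconnected Ω) (hne : Ωᶜ.Nonempty)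
    {g : ℂ → ℝ} (hg : ∀ x y, g x - g y ≤ ‖x - y‖) (hle : ∀ z ∈ Ω, infDist z Ωᶜ ≤ g z)
    (hx : x ∈ Ω) (hy : y ∈ Ω) : Real.log (g y) - Real.log (g x) ≤ qhDist Ω x y := by
  rw [qhDist_eq_weightedDist]
  obtain ⟨γ, a, b, h⟩ := exists_qhAdmissible hO hC hx hy
  refine le_csInf ⟨_, γ, a, b, h, rfl⟩ ?_
  rintro _ ⟨γ, a, b, h, rfl⟩
  have hw := isConformalWeight_inv_infDist hO hne
  obtain ⟨hab, ha, hb, hΩ, K, hK⟩ := id h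
  obtain ⟨m, hm, hmle⟩ : ∃ m > 0, ∀ t ∈ Icc a b, m ≤ g (γ t) := by
    obtain ⟨M, hM⟩ := hw.bounded (γ '' Icc a b) (image_subset_iff.2 hΩ)
      (isCompact_Icc.image_of_continuousOn h.continuousOn)
    refine ⟨1 / max M 1, by positivity, fun t ht => le_trans ?_ (hle _ (hΩ t ht))⟩
    have hpos := infDist_compl_pos hO hne (hΩ t ht)
    rw [one_div_le (by positivity) hpos]
    exact (hM _ (mem_image_of_mem γ ht)).trans (le_max_left _ _)
  have hlog : ∀ u v : ℝ, 0 < u → 0 < v → Real.log u - Real.log v ≤ (u - v) / v := by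
    intro u v hu hv
    rw [← Real.log_div hu.ne' hv.ne', sub_div, div_self hv.ne']
    exact Real.log_le_sub_one_of_pos (div_pos hu hv)
  have hgpos : ∀ t ∈ Icc a b, 0 < g (γ t) := fun t ht => hm.trans_le (hmle t ht)
  have hstep : ∀ s ∈ Icc a b, ∀ t ∈ Icc a b,
      Real.log (g (γ s)) - Real.log (g (γ t)) ≤ ‖γ s - γ t‖ / g (γ t) := fun s hs t ht =>
    (hlog _ _ (hgpos s hs) (hgpos t ht)).trans
      (div_le_div_of_nonneg_right (hg _ _) (hgpos t ht).le)
  have hLip : LipschitzOnWith (K / ⟨m, hm.le⟩) (fun t => Real.log (g (γ t))) (Icc a b) := by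
    have key : ∀ s ∈ Icc a b, ∀ t ∈ Icc a b,
        Real.log (g (γ s)) - Real.log (g (γ t)) ≤ K / m * dist s t := fun s hs t ht => by
      refine (hstep s hs t ht).trans ?_
      have h1 := hK.dist_le_mul s hs t ht
      rw [dist_eq_norm] at h1
      calc ‖γ s - γ t‖ / g (γ t) ≤ (K * dist s t) / m := by
            gcongr
            exact hmle t ht
        _ = K / m * dist s t := by ring
    refine LipschitzOnWith.of_dist_le_mul fun s hs t ht => ?_
    rw [Real.dist_eq]
    refine abs_le.2 ⟨?_, key s hs t ht⟩
    have h2 := key t ht s hs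
    rw [dist_comm] at h2
    have h3 : ((K / ⟨m, hm.le⟩ : ℝ≥0) : ℝ) = K / m := rfl
    rw [h3]
    linarith
  have hfin := sub_le_integral_of_local_le (c := fun t => 1 / infDist (γ t) Ωᶜ) hab hK hLip
    (fun t => hw.nonneg _) (h.intervalIntegrable hw) fun t ht s hs => by
      have ht' := Ioo_subset_Icc_self ht
      refine (hstep s hs t ht').trans ?_
      rw [div_eq_inv_mul, ← one_div]
      have h1 := infDist_compl_pos hO hne (hΩ t ht')
      have h2 := hle _ (hΩ t ht')
      gcongr
  rw [ha, hb] at hfin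
  exact hfin

/-- The Beardon–Pommerenke correction factor between the hyperbolic and quasihyperbolic
densities. -/
def bpFactor (Ω : Set ℂ) (z : ℂ) : ℝ :=
  1 + sInf {v : ℝ | ∃ a b, a ≠ b ∧ a ∉ Ω ∧ b ∉ Ω ∧
    v = |Real.log ‖z - a‖ - Real.log ‖b - a‖| + (Real.log ‖z - a‖ - Real.log (infDist z Ωᶜ))}

theorem bpTerm_nonneg (hO : IsOpen Ω) (hz : z ∈ Ω) {a : ℂ} (ha : a ∉ Ω) (u : ℝ) :
    0 ≤ |u| + (Real.log ‖z - a‖ - Real.log (infDist z Ωᶜ)) := by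
  have h := Real.log_le_log (infDist_compl_pos hO ⟨a, ha⟩ hz) (infDist_compl_le (x := z) ha)
  have := abs_nonneg u
  linarith

theorem one_le_bpFactor (hO : IsOpen Ω) (hz : z ∈ Ω) : 1 ≤ bpFactor Ω z := by
  have : 0 ≤ bpFactor Ω z - 1 := by
    rw [bpFactor, add_sub_cancel_left]
    refine Real.sInf_nonneg ?_
    rintro _ ⟨a, b, -, ha, -, rfl⟩
    exact bpTerm_nonneg hO hz ha _
  linarith

theorem bpFactor_le (hO : IsOpen Ω) (hz : z ∈ Ω) {a b : ℂ} (hab : a ≠ b) (ha : a ∉ Ω)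
    (hb : b ∉ Ω) : bpFactor Ω z ≤ 1 + (|Real.log ‖z - a‖ - Real.log ‖b - a‖| +
      (Real.log ‖z - a‖ - Real.log (infDist z Ωᶜ))) := by
  rw [bpFactor]
  gcongr
  refine csInf_le ⟨0, ?_⟩ ⟨a, b, hab, ha, hb, rfl⟩
  rintro _ ⟨a, b, -, ha, -, rfl⟩
  exact bpTerm_nonneg hO hz ha _

theorem le_bpFactor (hH : IsHyperbolicDomain Ω) {c : ℝ}
    (h : ∀ a b, a ≠ b → a ∉ Ω → b ∉ Ω → c ≤ 1 + (|Real.log ‖z - a‖ - Real.log ‖b - a‖| +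
      (Real.log ‖z - a‖ - Real.log (infDist z Ωᶜ)))) : c ≤ bpFactor Ω z := by
  obtain ⟨a, b, hab, ha, hb⟩ := hH
  rw [bpFactor, ← sub_le_iff_le_add']
  refine le_csInf ⟨_, a, b, hab, ha, hb, rfl⟩ ?_
  rintro _ ⟨a, b, hab, ha, hb, rfl⟩
  linarith [h a b hab ha hb]

theorem IsHyperbolicDomain.nonempty_compl (hH : IsHyperbolicDomain Ω) : Ωᶜ.Nonempty :=
  let ⟨a, _, _, ha, _⟩ := hH
  ⟨a, ha⟩

theorem bpFactor_le_add (hO : IsOpen Ω) (hC : IsPreconnected Ω) (hH : IsHyperbolicDomain Ω)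
    (hx : x ∈ Ω) (hy : y ∈ Ω) : bpFactor Ω y ≤ bpFactor Ω x + 3 * qhDist Ω x y := by
  have hne := hH.nonempty_compl
  rw [← sub_le_iff_le_add]
  refine le_bpFactor hH fun a b hab ha hb => ?_
  have h1 := bpFactor_le hO hy hab ha hb
  have hk : qhDist Ω y x = qhDist Ω x y := by
    rw [qhDist_eq_weightedDist, qhDist_eq_weightedDist, weightedDist_comm]
  have hg : ∀ u v : ℂ, ‖u - a‖ - ‖v - a‖ ≤ ‖u - v‖ := fun u v => by
    simpa using norm_sub_norm_le (u - a) (v - a)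
  have h2 := log_sub_log_le_qhDist hO hC hne hg (fun z _ => infDist_compl_le ha) hx hy
  have h3 := log_sub_log_le_qhDist hO hC hne hg (fun z _ => infDist_compl_le ha) hy hx
  have hδ : ∀ u v : ℂ, infDist u Ωᶜ - infDist v Ωᶜ ≤ ‖u - v‖ := fun u v => by
    have := infDist_le_infDist_add_dist (s := Ωᶜ) (x := u) (y := v)
    rw [dist_eq_norm] at this
    linarith
  have h4 := log_sub_log_le_qhDist hO hC hne hδ (fun z _ => le_rfl) hy hx
  rw [hk] at h3 h4
  have h5 : |Real.log ‖y - a‖ - Real.log ‖b - a‖| ≤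
      |Real.log ‖x - a‖ - Real.log ‖b - a‖| + |Real.log ‖y - a‖ - Real.log ‖x - a‖| := by
    refine le_trans (le_of_eq ?_) (abs_add_le _ _)
    congr 1
    ring
  have h6 : |Real.log ‖y - a‖ - Real.log ‖x - a‖| ≤ qhDist Ω x y :=
    abs_le.2 ⟨by linarith, h2⟩
  linarith

theorem norm_deriv_le_mul_bpFactor (hO : IsOpen Ω) (hH : IsHyperbolicDomain Ω) {f : ℂ → ℂ}
    (hf : DifferentiableOn ℂ f (ball 0 1)) (hm : MapsTo f (ball 0 1) Ω) :
    ‖deriv f 0‖ ≤ 20000 * (infDist (f 0) Ωᶜ * bpFactor Ω (f 0)) := by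
  have hne := hH.nonempty_compl
  set z := f 0
  have hz : z ∈ Ω := hm (mem_ball_self one_pos)
  have hδ := infDist_compl_pos hO hne hz
  obtain ⟨c, hc, hcd⟩ := hO.isClosed_compl.exists_infDist_eq_dist hne z
  rw [dist_eq_norm] at hcd
  set δ := infDist z Ωᶜ
  have omits : ∀ a ∉ Ω, ∀ ζ ∈ ball (0 : ℂ) 1, f ζ ≠ a := fun a ha ζ hζ h => ha (h ▸ hm hζ)
  have h1 := one_le_bpFactor hO hz
  suffices h : ‖deriv f 0‖ / (10000 * δ) - 1 ≤ bpFactor Ω z by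
    rw [sub_le_iff_le_add, div_le_iff₀ (by positivity)] at h
    nlinarith
  refine le_bpFactor hH fun a b hab ha hb => ?_
  rw [sub_le_iff_le_add, div_le_iff₀ (by positivity)]
  set v := |Real.log ‖z - a‖ - Real.log ‖b - a‖| + (Real.log ‖z - a‖ - Real.log δ) with hv
  have hδa : δ ≤ ‖z - a‖ := infDist_compl_le ha
  have hlδa : Real.log δ ≤ Real.log ‖z - a‖ := Real.log_le_log hδ hδa
  have hba : 0 < ‖b - a‖ := norm_pos_iff.2 (sub_ne_zero.2 hab.symm)
  have hlog2 : Real.log 2 ≤ 1 := by linarith [Real.log_two_lt_d9]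
  suffices h : ∃ e, e ∉ Ω ∧ c ≠ e ∧ |Real.log δ - Real.log ‖e - c‖| ≤ v + 1 by
    obtain ⟨e, he, hce, hle⟩ := h
    have h2 := norm_deriv_le_of_omits_pair hce hf (omits c hc) (omits e he)
    have hec : 0 < ‖e - c‖ := norm_pos_iff.2 (sub_ne_zero.2 hce.symm)
    rw [← hcd, Real.log_div hδ.ne' hec.ne'] at h2
    nlinarith
  have habs1 := le_abs_self (Real.log ‖z - a‖ - Real.log ‖b - a‖)
  have habs2 := neg_abs_le (Real.log ‖z - a‖ - Real.log ‖b - a‖)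
  have hdbl : ∀ u w : ℝ, 0 < u → 0 < w → u ≤ 2 * w → Real.log u ≤ Real.log w + 1 := by
    intro u w hu hw h
    have := Real.log_le_log hu h
    rw [Real.log_mul two_ne_zero hw.ne'] at this
    linarith
  have tri : ‖b - a‖ ≤ ‖b - c‖ + ‖a - c‖ := by
    have := norm_sub_le (b - c) (a - c)
    simpa using this
  have tri2 : ‖b - c‖ ≤ ‖b - a‖ + ‖a - c‖ := by
    have := norm_add_le (b - a) (a - c)
    simpa using this
  have tri3 : ‖a - c‖ ≤ ‖z - a‖ + δ := by
    have := norm_sub_le (z - c) (z - a)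
    rw [hcd]
    simp only [sub_sub_sub_cancel_left] at this
    linarith
  rcases le_or_gt ‖a - c‖ (‖b - a‖ / 2) with h | h
  · have hbc : 0 < ‖b - c‖ := by linarith
    refine ⟨b, hb, fun h' => ?_, ?_⟩
    · simp [h'] at hbc
    have h3 := hdbl _ _ hbc hba (by linarith)
    have h4 := hdbl _ _ hba hbc (by linarith)
    exact abs_le.2 ⟨by linarith, by linarith⟩
  · have hac : 0 < ‖a - c‖ := by linarith
    refine ⟨a, ha, fun h' => ?_, ?_⟩
    · simp [h'] at hac
    have h3 := hdbl _ _ hac (hδ.trans_le hδa) (by linarith)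
    have h4 := hdbl _ _ hba hac (by linarith)
    exact abs_le.2 ⟨by linarith, by linarith⟩

/-- The set of derivatives at `0` of holomorphic maps of the disc into `Ω` with `f 0 = w`. -/
def discDerivs (Ω : Set ℂ) (w : ℂ) : Set ℝ :=
  { r : ℝ | ∃ f : ℂ → ℂ, DifferentiableOn ℂ f (ball (0 : ℂ) 1) ∧
      MapsTo f (ball (0 : ℂ) 1) Ω ∧ f 0 = w ∧ r = ‖deriv f 0‖ }

theorem hypDensity_eq (w : ℂ) : hypDensity Ω w = 1 / sSup (discDerivs Ω w) := rfl

theorem bddAbove_discDerivs (hO : IsOpen Ω) (hH : IsHyperbolicDomain Ω) (w : ℂ) :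
    BddAbove (discDerivs Ω w) := by
  refine ⟨20000 * (infDist w Ωᶜ * bpFactor Ω w), ?_⟩
  rintro _ ⟨f, hf, hm, rfl, rfl⟩
  exact norm_deriv_le_mul_bpFactor hO hH hf hm

theorem infDist_le_sSup_discDerivs (hO : IsOpen Ω) (hH : IsHyperbolicDomain Ω) (hz : z ∈ Ω) :
    infDist z Ωᶜ ≤ sSup (discDerivs Ω z) := by
  have hδ := infDist_compl_pos hO hH.nonempty_compl hz
  refine le_csSup (bddAbove_discDerivs hO hH z)
    ⟨fun ζ => z + (infDist z Ωᶜ : ℝ) * ζ, by fun_prop, fun ζ hζ => ?_, by simp, ?_⟩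
  · refine ball_infDist_compl_subset (x := z) ?_
    rw [mem_ball_zero_iff] at hζ
    rw [mem_ball, dist_eq_norm, add_sub_cancel_left, norm_mul, Complex.norm_real,
      Real.norm_of_nonneg hδ.le]
    exact mul_lt_of_lt_one_right hδ hζ
  · have : HasDerivAt (fun ζ : ℂ => z + (infDist z Ωᶜ : ℝ) * ζ) ((infDist z Ωᶜ : ℝ) : ℂ) 0 := by
      simpa using ((hasDerivAt_id (0 : ℂ)).const_mul ((infDist z Ωᶜ : ℝ) : ℂ)).const_add z
    rw [this.deriv, Complex.norm_real, Real.norm_of_nonneg hδ.le]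

theorem mul_bpFactor_sub_one_le_sSup (hO : IsOpen Ω) (hH : IsHyperbolicDomain Ω) (hz : z ∈ Ω) :
    infDist z Ωᶜ * (bpFactor Ω z - 1) ≤ sSup (discDerivs Ω z) := by
  have hne := hH.nonempty_compl
  have hδ := infDist_compl_pos hO hne hz
  set t := bpFactor Ω z - 1 with ht
  rcases le_or_gt t 0 with ht0 | ht0
  · exact (mul_nonpos_of_nonneg_of_nonpos hδ.le ht0).trans
      (hδ.le.trans (infDist_le_sSup_discDerivs hO hH hz))
  obtain ⟨c, hc, hcd⟩ := hO.isClosed_compl.exists_infDist_eq_dist hne z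
  rw [dist_eq_norm] at hcd
  refine le_csSup (bddAbove_discDerivs hO hH z)
    ⟨fun ζ => c + (z - c) * Complex.exp (t * ζ), by fun_prop, fun ζ hζ => ?_, by simp, ?_⟩
  · by_contra hb
    set b := c + (z - c) * Complex.exp (t * ζ) with hbdef
    have hzc : 0 < ‖z - c‖ := hcd ▸ hδ
    have hbc : ‖b - c‖ = ‖z - c‖ * Real.exp (t * ζ.re) := by
      rw [hbdef, add_sub_cancel_left, norm_mul, Complex.norm_exp, Complex.re_ofReal_mul]
    have hcb : c ≠ b := fun h => by
      have : 0 < ‖b - c‖ := by rw [hbc]; positivity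
      simp [← h] at this
    have h1 := bpFactor_le hO hz hcb hc hb
    rw [hcd, hbc, Real.log_mul hzc.ne' (Real.exp_pos _).ne', Real.log_exp] at h1
    have h2 : |ζ.re| < 1 := (Complex.abs_re_le_norm ζ).trans_lt (mem_ball_zero_iff.1 hζ)
    have h3 : |Real.log ‖z - c‖ - (Real.log ‖z - c‖ + t * ζ.re)| = t * |ζ.re| := by
      rw [sub_add_cancel_left, abs_neg, abs_mul, abs_of_pos ht0]
    rw [h3] at h1
    nlinarith
  · have h1 : HasDerivAt (fun ζ : ℂ => c + (z - c) * Complex.exp (t * ζ)) ((z - c) * t) 0 := by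
      have h2 : HasDerivAt (fun ζ : ℂ => (t : ℂ) * ζ) (t : ℂ) 0 := by
        simpa using (hasDerivAt_id (0 : ℂ)).const_mul (t : ℂ)
      simpa using (h2.cexp.const_mul (z - c)).const_add c
    rw [h1.deriv, norm_mul, Complex.norm_real, Real.norm_of_nonneg ht0.le, hcd]

theorem hypDensity_le (hO : IsOpen Ω) (hH : IsHyperbolicDomain Ω) (hz : z ∈ Ω) :
    hypDensity Ω z ≤ 2 / (infDist z Ωᶜ * bpFactor Ω z) := by
  have hδ := infDist_compl_pos hO hH.nonempty_compl hz
  have h1 := infDist_le_sSup_discDerivs hO hH hz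
  have h2 := mul_bpFactor_sub_one_le_sSup hO hH hz
  have h3 := one_le_bpFactor hO hz
  rw [hypDensity_eq, div_le_div_iff₀ (by linarith) (by positivity)]
  nlinarith

theorem le_hypDensity (hO : IsOpen Ω) (hH : IsHyperbolicDomain Ω) (hz : z ∈ Ω) :
    1 / (20000 * (infDist z Ωᶜ * bpFactor Ω z)) ≤ hypDensity Ω z := by
  have hδ := infDist_compl_pos hO hH.nonempty_compl hz
  have h1 := infDist_le_sSup_discDerivs hO hH hz
  refine one_div_le_one_div_of_le (hδ.trans_le h1) (csSup_le ?_ ?_)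
  · by_contra h
    rw [not_nonempty_iff_eq_empty] at h
    rw [discDerivs, h, Real.sSup_empty] at h1
    linarith
  · rintro _ ⟨f, hf, hm, rfl, rfl⟩
    exact norm_deriv_le_mul_bpFactor hO hH hf hm

theorem isConformalWeight_hypDensity (hO : IsOpen Ω) (hH : IsHyperbolicDomain Ω) :
    IsConformalWeight Ω (hypDensity Ω) := by
  have hnn : ∀ w, 0 ≤ sSup (discDerivs Ω w) := fun w =>
    Real.sSup_nonneg (by rintro _ ⟨f, -, -, -, rfl⟩; exact norm_nonneg _)
  refine ⟨?_, fun z => one_div_nonneg.2 (hnn z), fun K hK hKc => ?_⟩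
  · refine Measurable.const_div (measurable_of_Ioi fun α => ?_) 1
    rcases lt_or_ge α 0 with hα | hα
    · convert MeasurableSet.univ
      exact eq_univ_of_forall fun w => hα.trans_le (hnn w)
    refine IsOpen.measurableSet (Metric.isOpen_iff.2 fun w hw => ?_)
    rw [mem_preimage, mem_Ioi, ← discDerivs] at hw
    have hne : (discDerivs Ω w).Nonempty := by
      by_contra h
      rw [not_nonempty_iff_eq_empty] at h
      rw [h, Real.sSup_empty] at hw
      linarith
    obtain ⟨_, ⟨f, hf, hm, rfl, rfl⟩, hlt⟩ := exists_lt_of_lt_csSup hne hw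
    have hd : 0 < ‖deriv f 0‖ := hα.trans_lt hlt
    obtain ⟨r, hr1, hr2⟩ := exists_between ((div_lt_one hd).2 hlt)
    have hr0 : 0 ≤ r := (div_nonneg hα hd.le).trans hr1.le
    rw [div_lt_iff₀ hd] at hr1
    have hsub : closedBall (0 : ℂ) r ⊆ ball 0 1 := closedBall_subset_ball hr2
    obtain ⟨ε, hε, hεsub⟩ := ((isCompact_closedBall (0 : ℂ) r).image_of_continuousOn
      (hf.continuousOn.mono hsub)).exists_thickening_subset_open hO
      (image_subset_iff.2 fun z hz => hm (hsub hz))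
    refine ⟨ε, hε, fun w' hw' => ?_⟩
    rw [mem_preimage, mem_Ioi]
    have hscale : ∀ ζ ∈ ball (0 : ℂ) 1, (r : ℂ) * ζ ∈ closedBall (0 : ℂ) r := fun ζ hζ => by
      rw [mem_ball_zero_iff] at hζ
      rw [mem_closedBall_zero_iff, norm_mul, Complex.norm_real, Real.norm_of_nonneg hr0]
      exact mul_le_of_le_one_right hr0 hζ.le
    refine hr1.trans_le (le_csSup (bddAbove_discDerivs hO hH w')
      ⟨fun ζ => f (r * ζ) + (w' - f 0), ?_, fun ζ hζ => hεsub ?_, by simp, ?_⟩)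
    · refine DifferentiableOn.add_const _ (hf.comp (by fun_prop) fun ζ hζ => hsub (hscale ζ hζ))
    · refine mem_thickening_iff.2 ⟨_, mem_image_of_mem f (hscale ζ hζ), ?_⟩
      rw [dist_eq_norm, add_sub_cancel_left, ← dist_eq_norm]
      exact hw'
    · have h1 : HasDerivAt f (deriv f 0) ((r : ℂ) * 0) := by
        rw [mul_zero]
        exact (hf.differentiableAt (ball_mem_nhds 0 one_pos)).hasDerivAt
      have h2 : HasDerivAt (fun ζ : ℂ => (r : ℂ) * ζ) (r : ℂ) 0 := by
        simpa using (hasDerivAt_id (0 : ℂ)).const_mul (r : ℂ)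
      have h3 := (h1.comp (0 : ℂ) h2).add_const (w' - f 0)
      have h4 : deriv (fun ζ : ℂ => f (r * ζ) + (w' - f 0)) 0 = deriv f 0 * r := h3.deriv
      rw [h4, norm_mul, Complex.norm_real, Real.norm_of_nonneg hr0, mul_comm]
  · obtain ⟨M, hM⟩ := (isConformalWeight_inv_infDist hO hH.nonempty_compl).bounded K hK hKc
    refine ⟨M, fun z hz => le_trans ?_ (hM z hz)⟩
    exact one_div_le_one_div_of_le (infDist_compl_pos hO hH.nonempty_compl (hK hz))
      (infDist_le_sSup_discDerivs hO hH (hK hz))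

end Weights

section Comparison

variable {Ω : Set ℂ} {x y z : ℂ}

theorem qhDist_nonneg (hO : IsOpen Ω) (hne : Ωᶜ.Nonempty) : 0 ≤ qhDist Ω x y := by
  rw [qhDist_eq_weightedDist]
  exact weightedDist_nonneg (isConformalWeight_inv_infDist hO hne).nonneg

theorem bpFactor_le_of_path (hO : IsOpen Ω) (hC : IsPreconnected Ω) (hH : IsHyperbolicDomain Ω)
    {γ : ℝ → ℂ} {a b t : ℝ} (h : qhAdmissible Ω x y γ a b) (ht : t ∈ Icc a b) :
    bpFactor Ω (γ t) ≤
      bpFactor Ω x + 3 * weightedLength (fun z => 1 / infDist z Ωᶜ) γ a t ∧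
    bpFactor Ω x ≤
      bpFactor Ω (γ t) + 3 * weightedLength (fun z => 1 / infDist z Ωᶜ) γ a t := by
  have h1 := h.restrict le_rfl ht.1 ht.2
  rw [h.2.1] at h1
  have hx : x ∈ Ω := h.2.1 ▸ h.2.2.2.1 a ⟨le_rfl, h.1⟩
  have ht' : γ t ∈ Ω := h.2.2.2.1 t ht
  have h2 := h1.weightedDist_le (isConformalWeight_inv_infDist hO hH.nonempty_compl).nonneg
  rw [← qhDist_eq_weightedDist] at h2
  have h3 := bpFactor_le_add hO hC hH hx ht'
  have h4 := bpFactor_le_add hO hC hH ht' hx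
  rw [qhDist_eq_weightedDist, weightedDist_comm, ← qhDist_eq_weightedDist] at h4
  constructor <;> linarith

theorem log_one_add_qhDist_le (hO : IsOpen Ω) (hC : IsPreconnected Ω)
    (hH : IsHyperbolicDomain Ω) (hx : x ∈ Ω) (hy : y ∈ Ω) :
    Real.log (1 + 3 * qhDist Ω x y / bpFactor Ω x) ≤ 60000 * hypDist Ω x y := by
  have hne := hH.nonempty_compl
  have hw := isConformalWeight_inv_infDist hO hne
  have hw' := isConformalWeight_hypDensity hO hH
  have hU := one_le_bpFactor hO hx
  suffices h : Real.log (1 + 3 * qhDist Ω x y / bpFactor Ω x) / 60000 ≤ hypDist Ω x y by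
    linarith
  obtain ⟨γ, a, b, h⟩ := exists_qhAdmissible hO hC hx hy
  refine le_csInf ⟨_, γ, a, b, h, rfl⟩ ?_
  rintro _ ⟨γ, a, b, h, rfl⟩
  rw [div_le_iff₀ (by norm_num)]
  set U := bpFactor Ω x
  set S : ℝ → ℝ := fun t => weightedLength (fun z => 1 / infDist z Ωᶜ) γ a t with hS
  have hSnn : ∀ t ∈ Icc a b, 0 ≤ S t := fun t ht => weightedLength_nonneg hw.nonneg ht.1
  have hSb : qhDist Ω x y ≤ S b := by
    rw [qhDist_eq_weightedDist]
    exact h.weightedDist_le hw.nonneg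
  have h_int := h.intervalIntegrable hw
  have h_int' := h.intervalIntegrable hw'
  obtain ⟨M, hM0, hM⟩ := h.exists_integrand_le hw
  have hSdiff : ∀ s ∈ Icc a b, ∀ t ∈ Icc a b, s ≤ t → 0 ≤ S t - S s ∧ S t - S s ≤ M * (t - s) := by
    intro s hs t ht hst
    have h1 := weightedLength_add hw (h.restrict le_rfl ht.1 ht.2) ⟨hs.1, hst⟩
    have h2 := weightedLength_nonneg (γ := γ) hw.nonneg hst
    have h3 : weightedLength (fun z => 1 / infDist z Ωᶜ) γ s t ≤ ∫ _ in s..t, M := by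
      refine intervalIntegral.integral_mono_on_of_le_Ioo hst
        ((h.restrict hs.1 hst ht.2).intervalIntegrable hw) intervalIntegrable_const
        fun u hu => hM u ⟨hs.1.trans_lt hu.1, hu.2.trans_le ht.2⟩
    simp only [intervalIntegral.integral_const, smul_eq_mul] at h3
    simp only [hS]
    constructor <;> linarith
  set G : ℝ → ℝ := fun t => Real.log (1 + 3 * S t / U) with hG
  have hpos : ∀ t ∈ Icc a b, 1 ≤ 1 + 3 * S t / U := fun t ht => by
    have := hSnn t ht
    have : 0 ≤ 3 * S t / U := by positivity
    linarith
  have hGL : LipschitzOnWith (3 * ⟨M, hM0⟩) G (Icc a b) := by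
    have key : ∀ s ∈ Icc a b, ∀ t ∈ Icc a b, s ≤ t → dist (G s) (G t) ≤ 3 * M * dist s t := by
      intro s hs t ht hst
      obtain ⟨h1, h2⟩ := hSdiff s hs t ht hst
      have h3 : 1 + 3 * S s / U ≤ 1 + 3 * S t / U := by
        gcongr
        linarith
      have hps := hpos s hs
      have h4 := Real.log_le_log (by linarith) h3
      have h5 := Real.log_le_sub_one_of_pos (x := (1 + 3 * S t / U) / (1 + 3 * S s / U))
        (div_pos (by linarith) (by linarith))
      rw [Real.log_div (by linarith) (by linarith)] at h5
      have h6 : (1 + 3 * S t / U) / (1 + 3 * S s / U) - 1 ≤ 3 * (S t - S s) := by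
        rw [sub_le_iff_le_add, div_le_iff₀ (by linarith)]
        have h7 : 3 * S t / U - 3 * S s / U ≤ 3 * (S t - S s) := by
          rw [← sub_div, ← mul_sub]
          exact div_le_self (by linarith) hU
        nlinarith
      rw [dist_comm, dist_comm s, Real.dist_eq, Real.dist_eq, abs_of_nonneg (sub_nonneg.2 h4),
        abs_of_nonneg (sub_nonneg.2 hst)]
      simp only [hG] at *
      nlinarith
    refine LipschitzOnWith.of_dist_le_mul fun s hs t ht => ?_
    have h3 : ((3 * ⟨M, hM0⟩ : ℝ≥0) : ℝ) = 3 * M := rfl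
    rw [h3]
    rcases le_total s t with hst | hst
    · exact key s hs t ht hst
    · rw [dist_comm, dist_comm s]
      exact key t ht s hs hst
  have hAC : AbsolutelyContinuousOnInterval G a b := by
    rw [← uIcc_of_le h.1] at hGL
    exact hGL.absolutelyContinuousOnInterval
  have hGa : G a = 0 := by simp [hG, hS, weightedLength]
  have hd := h_int.ae_hasDerivAt_integral
  have hmain : ∫ t in a..b, deriv G t ≤
      ∫ t in a..b, 60000 * (hypDensity Ω (γ t) * ‖deriv γ t‖) := by
    refine intervalIntegral.integral_mono_ae_restrict h.1 hAC.intervalIntegrable_deriv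
      (h_int'.const_mul _) ?_
    filter_upwards [ae_restrict_of_ae hd, ae_restrict_mem measurableSet_Icc] with t ht htI
    have hSd : HasDerivAt S (1 / infDist (γ t) Ωᶜ * ‖deriv γ t‖) t :=
      ht (by rwa [uIcc_of_le h.1]) a left_mem_uIcc
    have hpt := hpos t htI
    have hGd : HasDerivAt G (3 * (1 / infDist (γ t) Ωᶜ * ‖deriv γ t‖) / U / (1 + 3 * S t / U)) t :=
      (((hSd.const_mul 3).div_const U).const_add 1).log (by linarith)
    rw [hGd.deriv]
    have hγt := h.2.2.2.1 t htI
    have hδ := infDist_compl_pos hO hne hγt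
    have hUt := one_le_bpFactor hO hγt
    have hlow := le_hypDensity hO hH hγt
    have hup := (bpFactor_le_of_path hO hC hH h htI).1
    have hSt := hSnn t htI
    calc 3 * (1 / infDist (γ t) Ωᶜ * ‖deriv γ t‖) / U / (1 + 3 * S t / U)
        = 3 * (1 / (infDist (γ t) Ωᶜ * (U + 3 * S t))) * ‖deriv γ t‖ := by
          field_simp
      _ ≤ 3 * (1 / (infDist (γ t) Ωᶜ * bpFactor Ω (γ t))) * ‖deriv γ t‖ := by
          gcongr
      _ = 60000 * (1 / (20000 * (infDist (γ t) Ωᶜ * bpFactor Ω (γ t))) * ‖deriv γ t‖) := by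
          field_simp
          ring
      _ ≤ 60000 * (hypDensity Ω (γ t) * ‖deriv γ t‖) := by
          gcongr
  rw [hAC.integral_deriv_eq_sub, hGa, sub_zero, intervalIntegral.integral_const_mul] at hmain
  have hfin : Real.log (1 + 3 * qhDist Ω x y / U) ≤ G b := by
    have := qhDist_nonneg (x := x) (y := y) hO hne
    refine Real.log_le_log (by positivity) ?_
    gcongr
  calc _ ≤ G b := hfin
    _ ≤ _ := hmain
    _ = hypLength Ω γ a b * 60000 := mul_comm _ _

theorem hypDist_le_of_qhDist_lt (hO : IsOpen Ω) (hC : IsPreconnected Ω)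
    (hH : IsHyperbolicDomain Ω) (hx : x ∈ Ω) (hy : y ∈ Ω) {D : ℝ} (hD : qhDist Ω x y < D) :
    hypDist Ω x y ≤ 2 * (1 + 3 * D) * D / bpFactor Ω x := by
  have hne := hH.nonempty_compl
  have hw := isConformalWeight_inv_infDist hO hne
  have hw' := isConformalWeight_hypDensity hO hH
  have hU := one_le_bpFactor hO hx
  have hD0 : 0 < D := (qhDist_nonneg hO hne).trans_lt hD
  rw [qhDist_eq_weightedDist] at hD
  obtain ⟨γ, a, b, h, hl⟩ := exists_weightedLength_lt hO hC hx hy hD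
  set c := 2 * (1 + 3 * D) / bpFactor Ω x with hc
  have h1 : hypDist Ω x y ≤ weightedLength (hypDensity Ω) γ a b := h.weightedDist_le hw'.nonneg
  have h2 : weightedLength (hypDensity Ω) γ a b ≤
      ∫ t in a..b, c * (1 / infDist (γ t) Ωᶜ * ‖deriv γ t‖) := by
    refine intervalIntegral.integral_mono_on h.1 (h.intervalIntegrable hw')
      ((h.intervalIntegrable hw).const_mul c) fun t ht => ?_
    have hγt := h.2.2.2.1 t ht
    have hδ := infDist_compl_pos hO hne hγt
    have hUt := one_le_bpFactor hO hγt
    have hup := (bpFactor_le_of_path hO hC hH h ht).2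
    have hadd := weightedLength_add hw h ht
    have hnn := weightedLength_nonneg (γ := γ) hw.nonneg ht.2
    have hle : bpFactor Ω x ≤ (1 + 3 * D) * bpFactor Ω (γ t) := by nlinarith
    rw [← mul_assoc]
    gcongr
    refine (hypDensity_le hO hH hγt).trans ?_
    rw [hc, div_mul_div_comm, mul_one, div_le_div_iff₀ (by positivity) (by positivity)]
    nlinarith [mul_le_mul_of_nonneg_left hle hδ.le]
  rw [intervalIntegral.integral_const_mul] at h2
  have h3 : c * weightedLength (fun z => 1 / infDist z Ωᶜ) γ a b ≤ c * D := by gcongr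
  calc _ ≤ _ := h1
    _ ≤ _ := h2
    _ ≤ c * D := h3
    _ = _ := by rw [hc]; ring

theorem qhDist_pos (hO : IsOpen Ω) (hC : IsPreconnected Ω) (hne : Ωᶜ.Nonempty) (hx : x ∈ Ω)
    (hy : y ∈ Ω) (hxy : x ≠ y) : 0 < qhDist Ω x y := by
  have hδ := infDist_compl_pos hO hne hx
  have hn : 0 < ‖y - x‖ := norm_pos_iff.2 (sub_ne_zero.2 hxy.symm)
  have h := log_sub_log_le_qhDist hO hC hne (g := fun z => infDist x Ωᶜ + ‖z - x‖)
    (fun u v => by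
      have := norm_sub_norm_le (u - x) (v - x)
      rw [sub_sub_sub_cancel_right] at this
      linarith)
    (fun z _ => by
      have := infDist_le_infDist_add_dist (s := Ωᶜ) (x := z) (y := x)
      rwa [dist_eq_norm] at this) hx hy
  refine lt_of_lt_of_le (sub_pos.2 (Real.log_lt_log ?_ ?_)) h
  · simpa using hδ
  · simpa using hn

theorem isCompact_le_infDist_compl (hB : Bornology.IsBounded Ω) (ε : ℝ) :
    IsCompact {z ∈ closure Ω | ε ≤ infDist z Ωᶜ} :=
  (hB.isCompact_closure).inter_right (isClosed_le continuous_const (continuous_infDist_pt _))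

theorem le_infDist_compl_subset {ε : ℝ} (hε : 0 < ε) :
    {z ∈ closure Ω | ε ≤ infDist z Ωᶜ} ⊆ Ω := fun z hz => by
  by_contra h
  have : infDist z Ωᶜ = 0 := infDist_zero_of_mem h
  linarith [hz.2]

theorem infDist_compl_mul_exp_le (hO : IsOpen Ω) (hC : IsPreconnected Ω) (hne : Ωᶜ.Nonempty)
    (hx : x ∈ Ω) (hy : y ∈ Ω) {D : ℝ} (h : qhDist Ω x y ≤ D) :
    infDist x Ωᶜ * Real.exp (-D) ≤ infDist y Ωᶜ := by
  have h1 := log_sub_log_le_qhDist hO hC hne (g := fun z => infDist z Ωᶜ) (fun u v => by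
    have := infDist_le_infDist_add_dist (s := Ωᶜ) (x := u) (y := v)
    rw [dist_eq_norm] at this
    linarith) (fun z _ => le_rfl) hy hx
  rw [qhDist_eq_weightedDist, weightedDist_comm, ← qhDist_eq_weightedDist] at h1
  have hδx := infDist_compl_pos hO hne hx
  have hδy := infDist_compl_pos hO hne hy
  rw [← Real.exp_log hδx, ← Real.exp_add, ← Real.le_log_iff_exp_le hδy]
  linarith

end Comparison

section Geodesics

variable {Ω : Set ℂ} {ρ : ℂ → ℝ} {x y z : ℂ}

theorem tendsto_weightedDist_self (hρ : IsConformalWeight Ω ρ) (hO : IsOpen Ω) (hz : z ∈ Ω) :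
    Tendsto (fun w => weightedDist Ω ρ z w) (𝓝 z) (𝓝 0) := by
  obtain ⟨r, hr, hsub⟩ := Metric.nhds_basis_closedBall.mem_iff.1 (hO.mem_nhds hz)
  obtain ⟨M, hM⟩ := hρ.bounded _ hsub (isCompact_closedBall z r)
  have h0 : Tendsto (fun w => M * ‖w - z‖) (𝓝 z) (𝓝 0) := by
    have : Continuous fun w => M * ‖w - z‖ := by fun_prop
    simpa using this.tendsto z
  refine tendsto_of_tendsto_of_tendsto_of_le_of_le' tendsto_const_nhds h0
    (Eventually.of_forall fun w => weightedDist_nonneg hρ.nonneg) ?_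
  filter_upwards [ball_mem_nhds z hr] with w hw
  exact weightedDist_le_mul_norm hρ (ball_subset_closedBall.trans hsub)
    (fun u hu => hM u (ball_subset_closedBall hu)) hw

theorem exists_weightedDist_approx_geodesic (hρ : IsConformalWeight Ω ρ) (hO : IsOpen Ω)
    (hC : IsPreconnected Ω) (hx : x ∈ Ω) (hy : y ∈ Ω) (hpos : 0 < weightedDist Ω ρ x y)
    {c : ℝ} (hc : 1 < c) :
    ∃ g : ℝ → ℂ, g 0 = x ∧ g (weightedDist Ω ρ x y) = y ∧
      (∀ t ∈ Icc 0 (weightedDist Ω ρ x y), g t ∈ Ω) ∧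
      ∀ s ∈ Icc 0 (weightedDist Ω ρ x y), ∀ t ∈ Icc 0 (weightedDist Ω ρ x y),
        weightedDist Ω ρ (g s) (g t) ≤ c * |s - t| := by
  set T := weightedDist Ω ρ x y with hT
  obtain ⟨η, a, b, h, hl⟩ := exists_weightedLength_lt (ρ := ρ) hO hC hx hy
    (L := c * T) (lt_mul_of_one_lt_left hpos hc)
  set S : ℝ → ℝ := fun t => weightedLength ρ η a t with hS
  have hSa : S a = 0 := by simp [hS, weightedLength]
  have hSc : ContinuousOn S (Icc a b) := by
    have := intervalIntegral.continuousOn_primitive_interval' (h.intervalIntegrable hρ)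
      left_mem_uIcc
    rwa [uIcc_of_le h.1] at this
  have hSb : T ≤ S b := h.weightedDist_le hρ.nonneg
  have hτ : ∀ t ∈ Icc 0 T, ∃ τ ∈ Icc a b, S τ = t * (S b / T) ∧ (t = 0 → τ = a) ∧
      (t = T → τ = b) := by
    intro t ht
    rcases eq_or_ne t 0 with rfl | ht0
    · exact ⟨a, ⟨le_rfl, h.1⟩, by simp [hSa], fun _ => rfl, fun h => absurd h hpos.ne⟩
    rcases eq_or_ne t T with rfl | htT
    · exact ⟨b, ⟨h.1, le_rfl⟩, by field_simp, fun h => absurd h hpos.ne', fun _ => rfl⟩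
    have hmem : t * (S b / T) ∈ Icc (S a) (S b) := by
      have hSb0 : 0 < S b := hpos.trans_le hSb
      rw [hSa]
      refine ⟨mul_nonneg ht.1 (by positivity), ?_⟩
      rw [mul_div_assoc', div_le_iff₀ hpos, mul_comm]
      gcongr
      exact ht.2
    obtain ⟨τ, hτ, hτ'⟩ := intermediate_value_Icc h.1 hSc hmem
    exact ⟨τ, hτ, hτ', fun h => absurd h ht0, fun h => absurd h htT⟩
  choose! τ hτI hτS hτ0 hτT using hτ
  have h0 : (0 : ℝ) ∈ Icc 0 T := ⟨le_rfl, hpos.le⟩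
  have hTm : T ∈ Icc 0 T := ⟨hpos.le, le_rfl⟩
  refine ⟨fun t => η (τ t), ?_, ?_, fun t ht => h.2.2.2.1 _ (hτI t ht), fun s hs t ht => ?_⟩
  · simp only [hτ0 0 h0 rfl, h.2.1]
  · simp only [hτT T hTm rfl, h.2.2.1]
  have key : ∀ u ∈ Icc a b, ∀ v ∈ Icc a b, u ≤ v →
      weightedDist Ω ρ (η u) (η v) ≤ |S u - S v| := by
    intro u hu v hv huv
    have h1 := (h.restrict hu.1 huv hv.2).weightedDist_le hρ.nonneg
    have h2 := weightedLength_add hρ (h.restrict le_rfl hv.1 hv.2) ⟨hu.1, huv⟩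
    rw [abs_sub_comm]
    refine le_trans ?_ (le_abs_self _)
    simp only [hS]
    linarith
  have key' : weightedDist Ω ρ (η (τ s)) (η (τ t)) ≤ |S (τ s) - S (τ t)| := by
    rcases le_total (τ s) (τ t) with hst | hst
    · exact key _ (hτI s hs) _ (hτI t ht) hst
    · rw [weightedDist_comm, abs_sub_comm]
      exact key _ (hτI t ht) _ (hτI s hs) hst
  refine key'.trans ?_
  have hSb0 : 0 < S b := hpos.trans_le hSb
  rw [hτS s hs, hτS t ht, ← sub_mul, abs_mul, mul_comm, abs_of_pos (by positivity)]
  gcongr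
  rw [div_le_iff₀ hpos]
  exact hl.le

theorem exists_weightedDist_geodesic (hρ : IsConformalWeight Ω ρ) (hO : IsOpen Ω)
    (hC : IsPreconnected Ω) (hx : x ∈ Ω) (hy : y ∈ Ω) (hpos : 0 < weightedDist Ω ρ x y)
    {K : Set ℂ} (hK : IsCompact K) (hKΩ : K ⊆ Ω)
    (hball : ∀ z ∈ Ω, weightedDist Ω ρ x z ≤ weightedDist Ω ρ x y → z ∈ K) :
    ∃ g : ℝ → ℂ, g 0 = x ∧ g (weightedDist Ω ρ x y) = y ∧
      (∀ t ∈ Icc 0 (weightedDist Ω ρ x y), g t ∈ Ω) ∧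
      ∀ s ∈ Icc 0 (weightedDist Ω ρ x y), ∀ t ∈ Icc 0 (weightedDist Ω ρ x y),
        weightedDist Ω ρ (g s) (g t) = |s - t| := by
  set T := weightedDist Ω ρ x y with hT
  have happ : ∀ n : ℕ, ∃ g : ℝ → ℂ, g 0 = x ∧ g T = y ∧ (∀ t ∈ Icc 0 T, g t ∈ Ω) ∧
      ∀ s ∈ Icc 0 T, ∀ t ∈ Icc 0 T,
        weightedDist Ω ρ (g s) (g t) ≤ (1 + 1 / ((n : ℝ) + 1)) * |s - t| := fun n =>
    exists_weightedDist_approx_geodesic hρ hO hC hx hy hpos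
      (lt_add_of_pos_right _ (by positivity))
  choose G hG0 hGT hGΩ hGd using happ
  have hlimc : Tendsto (fun n : ℕ => 1 + 1 / ((n : ℝ) + 1)) (hyperfilter ℕ) (𝓝 1) := by
    have := (tendsto_one_div_add_atTop_nhds_zero_nat (𝕜 := ℝ)).const_add 1
    rw [add_zero] at this
    exact this.mono_left Nat.hyperfilter_le_atTop
  have h0 : (0 : ℝ) ∈ Icc 0 T := ⟨le_rfl, hpos.le⟩
  have hTm : T ∈ Icc 0 T := ⟨hpos.le, le_rfl⟩
  have hlim : ∀ t ∈ Icc 0 T, ∃ w ∈ K, Tendsto (fun n => G n t) (hyperfilter ℕ) (𝓝 w) := by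
    intro t ht
    have hev : ∀ᶠ n in (hyperfilter ℕ : Filter ℕ), G n t ∈ K := by
      rcases ht.2.eq_or_lt with rfl | hlt
      · exact Eventually.of_forall fun n => by rw [hGT]; exact hball y hy le_rfl
      · have h1 : Tendsto (fun n : ℕ => (1 + 1 / ((n : ℝ) + 1)) * |0 - t|) (hyperfilter ℕ)
            (𝓝 (1 * |0 - t|)) := hlimc.mul_const _
        rw [one_mul, zero_sub, abs_neg, abs_of_nonneg ht.1] at h1
        filter_upwards [h1.eventually_lt_const hlt] with n hn
        refine hball _ (hGΩ n t ht) ?_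
        have h2 := hGd n 0 h0 t ht
        rw [hG0, zero_sub, abs_neg, abs_of_nonneg ht.1] at h2
        exact h2.trans hn.le
    obtain ⟨w, hw, hle⟩ := hK.ultrafilter_le_nhds ((hyperfilter ℕ).map fun n => G n t)
      (le_principal_iff.2 hev)
    exact ⟨w, hw, hle⟩
  choose! g hgK hgl using hlim
  have hgΩ : ∀ t ∈ Icc 0 T, g t ∈ Ω := fun t ht => hKΩ (hgK t ht)
  have hg0 : g 0 = x := tendsto_nhds_unique (hgl 0 h0) (by simp [hG0])
  have hgT : g T = y := tendsto_nhds_unique (hgl T hTm) (by simp [hGT])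
  have hle : ∀ s ∈ Icc 0 T, ∀ t ∈ Icc 0 T, weightedDist Ω ρ (g s) (g t) ≤ |s - t| := by
    intro s hs t ht
    have h1 := (tendsto_weightedDist_self hρ hO (hgΩ s hs)).comp (hgl s hs)
    have h2 := (tendsto_weightedDist_self hρ hO (hgΩ t ht)).comp (hgl t ht)
    have h3 := (h1.add (hlimc.mul_const |s - t|)).add h2
    rw [zero_add, one_mul, add_zero] at h3
    refine ge_of_tendsto h3 (Eventually.of_forall fun n => ?_)
    have h4 := weightedDist_triangle hρ hO hC (hgΩ s hs) (hGΩ n s hs) (hgΩ t ht)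
    have h5 := weightedDist_triangle hρ hO hC (hGΩ n s hs) (hGΩ n t ht) (hgΩ t ht)
    have h6 := hGd n s hs t ht
    rw [weightedDist_comm (x := G n t)] at h5
    simp only [Function.comp_apply]
    linarith
  have hge : ∀ s ∈ Icc 0 T, ∀ t ∈ Icc 0 T, s ≤ t → t - s ≤ weightedDist Ω ρ (g s) (g t) := by
    intro s hs t ht hst
    have h1 := hle 0 h0 s hs
    have h2 := hle t ht T hTm
    rw [hg0, zero_sub, abs_neg, abs_of_nonneg hs.1] at h1
    rw [hgT, abs_sub_comm, abs_of_nonneg (by linarith [ht.2])] at h2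
    have h3 := weightedDist_triangle hρ hO hC hx (hgΩ s hs) hy
    have h4 := weightedDist_triangle hρ hO hC (hgΩ s hs) (hgΩ t ht) hy
    linarith
  refine ⟨g, hg0, hgT, hgΩ, fun s hs t ht => le_antisymm (hle s hs t ht) ?_⟩
  rcases le_total s t with hst | hst
  · rw [abs_sub_comm, abs_of_nonneg (sub_nonneg.2 hst)]
    exact hge s hs t ht hst
  · rw [abs_of_nonneg (sub_nonneg.2 hst), weightedDist_comm]
    exact hge t ht s hs hst

end Geodesics

section Stability

variable {X : Type*}

/-- The Gromov product of a distance function. -/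
def gromovProd (k : X → X → ℝ) (o x y : X) : ℝ := (k x o + k o y - k x y) / 2

/-- `γ` is a unit-speed geodesic on `s` for the distance function `d`. -/
def IsUnitGeodesicOn (d : X → X → ℝ) (γ : ℝ → X) (s : Set ℝ) : Prop :=
  ∀ a ∈ s, ∀ b ∈ s, d (γ a) (γ b) = |a - b|

/-- The relations between a Gromov hyperbolic distance `k` and a second distance `h`, comparable
to `k` up to a slowly varying conformal factor `U`, from which geodesic stability follows. -/
structure IsSlowlyConformal (k h : X → X → ℝ) (U : X → ℝ) (δ c : ℝ) : Prop where
  k_self : ∀ x, k x x = 0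
  k_nonneg : ∀ x y, 0 ≤ k x y
  k_comm : ∀ x y, k x y = k y x
  k_triangle : ∀ x y z, k x z ≤ k x y + k y z
  h_comm : ∀ x y, h x y = h y x
  h_triangle : ∀ x y z, h x z ≤ h x y + h y z
  one_le_U : ∀ x, 1 ≤ U x
  U_le : ∀ x y, U y ≤ U x + 3 * k x y
  one_le_c : 1 ≤ c
  log_le : ∀ x y, Real.log (1 + 3 * k x y / U x) ≤ c * h x y
  exists_h_le : ∀ D : ℝ, ∃ C : ℝ, 0 < C ∧ ∀ x y, k x y ≤ D → h x y ≤ C / U x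
  one_le_δ : 1 ≤ δ
  four_point : ∀ o x y z, min (gromovProd k o x y) (gromovProd k o y z) - δ ≤ gromovProd k o x z

variable {k h : X → X → ℝ} {U : X → ℝ} {δ c : ℝ}

namespace IsSlowlyConformal

theorem gromovProd_nonneg (H : IsSlowlyConformal k h U δ c) (o x y : X) :
    0 ≤ gromovProd k o x y := by
  have := H.k_triangle x o y
  unfold gromovProd
  linarith

theorem gromovProd_comm (H : IsSlowlyConformal k h U δ c) (o x y : X) :
    gromovProd k o x y = gromovProd k o y x := by
  unfold gromovProd
  rw [H.k_comm x o, H.k_comm o y, H.k_comm x y]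
  ring

theorem k_le (H : IsSlowlyConformal k h U δ c) (x y : X) :
    3 * k x y ≤ U x * (Real.exp (c * h x y) - 1) := by
  have h1 := H.log_le x y
  have h2 := H.one_le_U x
  have h3 := H.k_nonneg x y
  rw [Real.log_le_iff_le_exp (by positivity), ← le_sub_iff_add_le',
    div_le_iff₀ (by linarith)] at h1
  linarith

theorem U_le_mul_exp (H : IsSlowlyConformal k h U δ c) (x y : X) :
    U y ≤ U x * Real.exp (c * h x y) := by
  have h1 := H.k_le x y
  have h2 := H.U_le x y
  linarith

theorem le_gromovProd_of_chain (H : IsSlowlyConformal k h U δ c) {z : ℕ → X} {q : X} {r : ℝ}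
    {n : ℕ} (hstep : ∀ i < n, k (z i) (z (i + 1)) ≤ 1) (hr : ∀ i ≤ n, r ≤ k (z i) q) (N : ℕ) :
    ∀ i m, m ≤ 2 ^ N → i + m ≤ n → r - 1 / 2 - N * δ ≤ gromovProd k q (z i) (z (i + m)) := by
  induction N with
  | zero =>
    intro i m hm him
    have h1 := hr i (by omega)
    have h2 := hr (i + m) him
    have h3 : k (z i) (z (i + m)) ≤ 1 := by
      obtain rfl | rfl : m = 0 ∨ m = 1 := by simp at hm; omega
      · rw [add_zero, H.k_self]
        exact zero_le_one
      · exact hstep i (by omega)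
    unfold gromovProd
    rw [H.k_comm q]
    push_cast
    linarith
  | succ N ih =>
    intro i m hm him
    rw [pow_succ] at hm
    obtain ⟨m₁, m₂, rfl, h1, h2⟩ : ∃ m₁ m₂, m = m₁ + m₂ ∧ m₁ ≤ 2 ^ N ∧ m₂ ≤ 2 ^ N :=
      ⟨m / 2, m - m / 2, by omega, by omega, by omega⟩
    have h3 := ih i m₁ h1 (by omega)
    have h4 := ih (i + m₁) m₂ h2 (by omega)
    have h5 := H.four_point q (z i) (z (i + m₁)) (z (i + m₁ + m₂))
    have h6 := le_min h3 h4
    rw [← add_assoc]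
    push_cast
    linarith

theorem le_gromovProd_of_geodesic (H : IsSlowlyConformal k h U δ c) {γ : ℝ → X} {s t : ℝ}
    (hst : s ≤ t) (hγ : IsUnitGeodesicOn h γ (Icc s t)) {q : X} {r W : ℝ}
    (hr : ∀ u ∈ Icc s t, r ≤ k (γ u) q) (hW : ∀ u ∈ Icc s t, U (γ u) ≤ W) {N : ℕ}
    (hN : c * W * (t - s) + 1 ≤ 2 ^ N) :
    r - 1 / 2 - N * δ ≤ gromovProd k q (γ s) (γ t) := by
  have hW1 : 1 ≤ W := (H.one_le_U _).trans (hW s ⟨le_rfl, hst⟩)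
  have hc := H.one_le_c
  have hcW : 0 < c * W := by positivity
  obtain ⟨n, hn0, hn1, hn2⟩ : ∃ n : ℕ, 0 < n ∧ c * W * (t - s) ≤ n ∧ n ≤ 2 ^ N := by
    refine ⟨⌊c * W * (t - s)⌋₊ + 1, Nat.succ_pos _, ?_, ?_⟩
    · push_cast
      exact (Nat.lt_floor_add_one _).le
    · have h1 := Nat.floor_le (mul_nonneg hcW.le (sub_nonneg.2 hst))
      have : ((⌊c * W * (t - s)⌋₊ + 1 : ℕ) : ℝ) ≤ ((2 ^ N : ℕ) : ℝ) := by
        push_cast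
        linarith
      exact_mod_cast this
  have hn0' : (0 : ℝ) < n := by exact_mod_cast hn0
  have hts : 0 ≤ t - s := sub_nonneg.2 hst
  have hmem : ∀ i ≤ n, s + (t - s) * (i / n) ∈ Icc s t := fun i hi => by
    have h1 : (i : ℝ) / n ≤ 1 := (div_le_one hn0').2 (by exact_mod_cast hi)
    have h2 : 0 ≤ (t - s) * ((i : ℝ) / n) := by positivity
    have h3 := mul_le_of_le_one_right hts h1
    exact ⟨by linarith, by linarith⟩
  have hmain := H.le_gromovProd_of_chain (z := fun i => γ (s + (t - s) * (i / n))) (q := q) (r := r)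
    (n := n) (fun i hi => ?_) (fun i hi => hr _ (hmem i hi)) N 0 n hn2 (by omega)
  · simpa [div_self hn0'.ne'] using hmain
  · have h1 := H.k_le (γ (s + (t - s) * (i / n))) (γ (s + (t - s) * ((i + 1 : ℕ) / n)))
    have h2 : h (γ (s + (t - s) * (i / n))) (γ (s + (t - s) * ((i + 1 : ℕ) / n))) =
        (t - s) / n := by
      rw [hγ _ (hmem i hi.le) _ (hmem (i + 1) hi), abs_sub_comm,
        ← abs_of_nonneg (div_nonneg hts hn0'.le)]
      congr 1
      push_cast
      ring
    rw [h2] at h1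
    have h3 : c * ((t - s) / n) ≤ 1 / W := by
      rw [mul_div_assoc', div_le_div_iff₀ hn0' (by linarith)]
      linarith
    have h4 : 0 ≤ c * ((t - s) / n) := by positivity
    have h5 : (1 : ℝ) / W ≤ 1 := (div_le_one (by linarith)).2 hW1
    have h6 := Real.abs_exp_sub_one_le (x := c * ((t - s) / n))
      (abs_le.2 ⟨by linarith, by linarith⟩)
    rw [abs_of_nonneg h4] at h6
    have h7 := (le_abs_self _).trans h6
    have h8 := hW _ (hmem i hi.le)
    have h9 := H.one_le_U (γ (s + (t - s) * (i / n)))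
    have h10 : U (γ (s + (t - s) * (i / n))) * (Real.exp (c * ((t - s) / n)) - 1) ≤
        W * (2 * (1 / W)) :=
      mul_le_mul h8 (by linarith) (by linarith [Real.add_one_le_exp (c * ((t - s) / n))])
        (by linarith)
    have h11 : W * (2 * (1 / W)) = 2 := by field_simp
    linarith

theorem exists_le_pow {A κ : ℝ} (hA : 0 ≤ A) (hκ : 1 ≤ κ) :
    ∃ D : ℝ, 0 ≤ D ∧ ∀ r ≥ D, ∃ N : ℕ, A * (4 + 3 * r) + 1 ≤ 2 ^ N ∧ 2 * κ < r - 1 / 2 - N * κ := by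
  set b := Real.log 2 / (2 * κ) with hb
  have hl2 : 0 < Real.log 2 := Real.log_pos one_lt_two
  have hb0 : 0 < b := by positivity
  refine ⟨max (2 + 6 * κ) (2 * (7 * A + 1) / b ^ 2), by positivity, fun r hr => ?_⟩
  have hr1 : 2 + 6 * κ ≤ r := (le_max_left _ _).trans hr
  have hr2 : 2 * (7 * A + 1) / b ^ 2 ≤ r := (le_max_right _ _).trans hr
  have hr0 : 0 < r := by linarith
  refine ⟨⌈r / (2 * κ)⌉₊, ?_, ?_⟩
  · have h1 : Real.exp (b * r) ≤ 2 ^ ⌈r / (2 * κ)⌉₊ := by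
      rw [← Real.exp_log (show (0 : ℝ) < 2 ^ ⌈r / (2 * κ)⌉₊ by positivity), Real.log_pow]
      refine Real.exp_le_exp.2 ?_
      have h2 := Nat.le_ceil (r / (2 * κ))
      calc b * r = r / (2 * κ) * Real.log 2 := by rw [hb]; ring
        _ ≤ _ := by gcongr
    refine le_trans ?_ h1
    have h3 := Real.quadratic_le_exp_of_nonneg (x := b * r) (by positivity)
    rw [div_le_iff₀ (by positivity)] at hr2
    have h4 : 0 ≤ b * r := by positivity
    nlinarith [mul_le_mul_of_nonneg_right hr2 hr0.le,
      mul_nonneg hA (sub_nonneg.2 (by linarith : 1 ≤ r))]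
  · have h2 := Nat.ceil_lt_add_one (show 0 ≤ r / (2 * κ) by positivity)
    have h3 : (⌈r / (2 * κ)⌉₊ : ℝ) * κ ≤ (r / (2 * κ) + 1) * κ := by gcongr
    have h4 : (r / (2 * κ) + 1) * κ = r / 2 + κ := by field_simp
    linarith

/-- Geodesics of `h` passing far from `q` need much time to travel around `q`. -/
theorem exists_forall_div_le (H : IsSlowlyConformal k h U δ c) {B : ℝ} (hB : 0 < B) :
    ∃ D : ℝ, 0 ≤ D ∧ ∀ (γ : ℝ → X) (s t : ℝ) (q : X), s ≤ t → IsUnitGeodesicOn h γ (Icc s t) →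
      (∀ u ∈ Icc s t, D ≤ k (γ u) q) → gromovProd k q (γ s) (γ t) ≤ 2 * δ →
      B / U q ≤ t - s := by
  have hc := H.one_le_c
  obtain ⟨D, hD0, hD⟩ := exists_le_pow (A := c * Real.exp (c * B) * B) (by positivity) H.one_le_δ
  refine ⟨D, hD0, fun γ s t q hst hγ hk hgp => ?_⟩
  by_contra! hlt
  have hU := H.one_le_U q
  have hne : ((fun u => k (γ u) q) '' Icc s t).Nonempty := ⟨_, s, ⟨le_rfl, hst⟩, rfl⟩
  set r := sInf ((fun u => k (γ u) q) '' Icc s t) with hr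
  have hrk : ∀ u ∈ Icc s t, r ≤ k (γ u) q := fun u hu => by
    refine csInf_le ⟨0, ?_⟩ ⟨u, hu, rfl⟩
    rintro _ ⟨v, -, rfl⟩
    exact H.k_nonneg _ _
  have hDr : D ≤ r := le_csInf hne (by rintro _ ⟨v, hv, rfl⟩; exact hk v hv)
  obtain ⟨_, ⟨v, hv, rfl⟩, hvr⟩ := exists_lt_of_csInf_lt hne (lt_add_one r)
  change k (γ v) q < r + 1 at hvr
  obtain ⟨N, hN1, hN2⟩ := hD r hDr
  have hBU : B / U q ≤ B := div_le_self hB.le hU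
  have hUv : U (γ v) ≤ U q * (4 + 3 * r) := by
    have h1 := H.U_le q (γ v)
    rw [H.k_comm] at h1
    nlinarith
  have hW : ∀ u ∈ Icc s t, U (γ u) ≤ U q * (4 + 3 * r) * Real.exp (c * B) := fun u hu => by
    have h1 := H.U_le_mul_exp (γ v) (γ u)
    rw [hγ v hv u hu] at h1
    have h2 : |v - u| ≤ B := abs_le.2 ⟨by linarith [hv.1, hu.2], by linarith [hv.2, hu.1]⟩
    have h3 := H.one_le_U (γ v)
    have h4 : 0 ≤ U q * (4 + 3 * r) := by linarith
    calc U (γ u) ≤ U (γ v) * Real.exp (c * |v - u|) := h1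
      _ ≤ _ := by gcongr
  have hmain := H.le_gromovProd_of_geodesic hst hγ hrk hW (N := N) (le_trans ?_ hN1)
  · linarith
  · have h1 : U q * (t - s) ≤ B := by
      rw [lt_div_iff₀ (by linarith)] at hlt
      linarith
    have h2 : 0 ≤ c * Real.exp (c * B) * (4 + 3 * r) := by
      have : 0 ≤ r := hD0.trans hDr
      positivity
    nlinarith [mul_le_mul_of_nonneg_left h1 h2]

/-- The projection parameter of `z` onto the geodesic `σ` of length `L`. -/
def projParam (k : X → X → ℝ) (σ : ℝ → X) (L : ℝ) (z : X) : ℝ :=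
  (L + k z (σ 0) - k z (σ L)) / 2

section Projection

variable {σ : ℝ → X} {L : ℝ}

theorem k_ends (hσ : IsUnitGeodesicOn k σ (Icc 0 L)) {a : ℝ} (ha : a ∈ Icc 0 L) :
    k (σ a) (σ 0) = a ∧ k (σ a) (σ L) = L - a := by
  have hL : 0 ≤ L := ha.1.trans ha.2
  rw [hσ a ha 0 ⟨le_rfl, hL⟩, hσ a ha L ⟨hL, le_rfl⟩, sub_zero, abs_of_nonneg ha.1,
    abs_sub_comm, abs_of_nonneg (sub_nonneg.2 ha.2)]
  exact ⟨rfl, rfl⟩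

theorem projParam_mem (H : IsSlowlyConformal k h U δ c) (hL : 0 ≤ L)
    (hσ : IsUnitGeodesicOn k σ (Icc 0 L)) (z : X) : projParam k σ L z ∈ Icc 0 L := by
  have h1 := (k_ends hσ (⟨le_rfl, hL⟩ : (0 : ℝ) ∈ Icc 0 L)).2
  have h2 := H.k_triangle z (σ 0) (σ L)
  have h3 := H.k_triangle z (σ L) (σ 0)
  rw [H.k_comm (σ L)] at h3
  unfold projParam
  constructor <;> linarith

theorem abs_projParam_sub_le (H : IsSlowlyConformal k h U δ c) (z w : X) :
    |projParam k σ L z - projParam k σ L w| ≤ k z w := by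
  have h1 := H.k_triangle z w (σ 0)
  have h2 := H.k_triangle w z (σ 0)
  have h3 := H.k_triangle z w (σ L)
  have h4 := H.k_triangle w z (σ L)
  rw [H.k_comm w z] at h2 h4
  unfold projParam
  exact abs_le.2 ⟨by linarith, by linarith⟩

theorem abs_k_proj_sub_le (H : IsSlowlyConformal k h U δ c) (hL : 0 ≤ L)
    (hσ : IsUnitGeodesicOn k σ (Icc 0 L)) (z w : X) :
    |k z (σ (projParam k σ L z)) - k w (σ (projParam k σ L w))| ≤ 2 * k z w := by
  have h1 := H.abs_projParam_sub_le (σ := σ) (L := L) z w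
  have h2 := hσ _ (H.projParam_mem hL hσ z) _ (H.projParam_mem hL hσ w)
  have h3 := H.k_triangle z w (σ (projParam k σ L z))
  have h4 := H.k_triangle w z (σ (projParam k σ L w))
  have h5 := H.k_triangle w (σ (projParam k σ L w)) (σ (projParam k σ L z))
  have h6 := H.k_triangle z (σ (projParam k σ L z)) (σ (projParam k σ L w))
  rw [H.k_comm (σ (projParam k σ L w))] at h5
  rw [H.k_comm w z] at h4
  exact abs_le.2 ⟨by linarith, by linarith⟩

theorem gromovProd_sub_gromovProd (hσ : IsUnitGeodesicOn k σ (Icc 0 L)) {a : ℝ}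
    (ha : a ∈ Icc 0 L) (z : X) :
    gromovProd k (σ a) z (σ L) - gromovProd k (σ a) z (σ 0) = projParam k σ L z - a := by
  obtain ⟨h1, h2⟩ := k_ends hσ ha
  unfold gromovProd projParam
  rw [h1, h2]
  ring

theorem gromovProd_proj_le (H : IsSlowlyConformal k h U δ c) (hL : 0 ≤ L)
    (hσ : IsUnitGeodesicOn k σ (Icc 0 L)) (z : X) :
    gromovProd k (σ (projParam k σ L z)) z (σ 0) ≤ δ ∧
      gromovProd k (σ (projParam k σ L z)) z (σ L) ≤ δ := by
  have ha := H.projParam_mem hL hσ z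
  have h1 := gromovProd_sub_gromovProd hσ ha z
  have h2 := H.four_point (σ (projParam k σ L z)) (σ 0) z (σ L)
  have h3 : gromovProd k (σ (projParam k σ L z)) (σ 0) (σ L) = 0 := by
    obtain ⟨h4, h5⟩ := k_ends hσ ha
    have h6 := (k_ends hσ (⟨le_rfl, hL⟩ : (0 : ℝ) ∈ Icc 0 L)).2
    unfold gromovProd
    rw [H.k_comm (σ 0), h4, h5, h6]
    ring
  rw [sub_self, sub_eq_zero] at h1
  rw [h3, H.gromovProd_comm _ (σ 0), h1, min_self] at h2
  constructor <;> linarith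

theorem k_proj_le (H : IsSlowlyConformal k h U δ c) (hL : 0 ≤ L)
    (hσ : IsUnitGeodesicOn k σ (Icc 0 L)) (z : X) {a : ℝ} (ha : a ∈ Icc 0 L) :
    k z (σ (projParam k σ L z)) ≤ k z (σ a) + 2 * δ := by
  obtain ⟨h1, h2⟩ := H.gromovProd_proj_le hL hσ z
  obtain ⟨h3, h4⟩ := k_ends hσ (H.projParam_mem hL hσ z)
  obtain ⟨h5, h6⟩ := k_ends hσ ha
  have h7 := H.k_triangle z (σ a) (σ 0)
  have h8 := H.k_triangle z (σ a) (σ L)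
  unfold gromovProd at h1 h2
  rcases le_total a (projParam k σ L z) with h | h <;> linarith

theorem gromovProd_le_of_projParam_add_le (H : IsSlowlyConformal k h U δ c) (hL : 0 ≤ L)
    (hσ : IsUnitGeodesicOn k σ (Icc 0 L)) {z w : X}
    (hzw : projParam k σ L z + (2 * δ + 1) ≤ projParam k σ L w) :
    gromovProd k (σ (projParam k σ L z)) z w ≤ 2 * δ := by
  have ha := H.projParam_mem hL hσ z
  have h1 := gromovProd_sub_gromovProd hσ ha w
  have h2 := H.gromovProd_nonneg (σ (projParam k σ L z)) w (σ 0)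
  have h3 := H.four_point (σ (projParam k σ L z)) z w (σ L)
  have h4 := (H.gromovProd_proj_le hL hσ z).2
  by_contra! h5
  have h6 := lt_min h5 (show 2 * δ < gromovProd k (σ (projParam k σ L z)) w (σ L) by linarith)
  linarith

end Projection

theorem continuousOn_comp_geodesic (H : IsSlowlyConformal k h U δ c) {γ : ℝ → X} {s : Set ℝ}
    (hγ : IsUnitGeodesicOn h γ s) {F : X → ℝ} (hF : ∀ z w, |F z - F w| ≤ 2 * k z w) :
    ContinuousOn (fun t => F (γ t)) s := by
  intro t ht
  rw [ContinuousWithinAt, tendsto_iff_dist_tendsto_zero]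
  have h1 : Tendsto (fun u => U (γ t) * (Real.exp (c * |t - u|) - 1)) (𝓝[s] t) (𝓝 0) := by
    have : Continuous fun u => U (γ t) * (Real.exp (c * |t - u|) - 1) := by fun_prop
    simpa using this.continuousWithinAt.tendsto (x := t) (s := s)
  refine squeeze_zero' (Eventually.of_forall fun u => dist_nonneg) ?_ h1
  filter_upwards [self_mem_nhdsWithin] with u hu
  have h2 := H.k_le (γ t) (γ u)
  rw [hγ t ht u hu] at h2
  have h3 := hF (γ t) (γ u)
  have h4 := H.k_nonneg (γ t) (γ u)
  rw [dist_comm, Real.dist_eq]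
  linarith

end IsSlowlyConformal

theorem IsUnitGeodesicOn.mono {d : X → X → ℝ} {γ : ℝ → X} {s t : Set ℝ}
    (hγ : IsUnitGeodesicOn d γ t) (hst : s ⊆ t) : IsUnitGeodesicOn d γ s :=
  fun a ha b hb => hγ a (hst ha) b (hst hb)

namespace IsSlowlyConformal

variable {σ : ℝ → X} {L : ℝ}

theorem projParam_reverse (z : X) :
    projParam k (fun a => σ (L - a)) L z = L - projParam k σ L z := by
  unfold projParam
  simp only [sub_zero, sub_self]
  ring

theorem isUnitGeodesicOn_reverse (hσ : IsUnitGeodesicOn k σ (Icc 0 L)) :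
    IsUnitGeodesicOn k (fun a => σ (L - a)) (Icc 0 L) := fun a ha b hb => by
  rw [hσ (L - a) ⟨by linarith [ha.2], by linarith [ha.1]⟩ (L - b)
    ⟨by linarith [hb.2], by linarith [hb.1]⟩, abs_sub_comm]
  congr 1
  ring

theorem continuousOn_projParam (H : IsSlowlyConformal k h U δ c) {γ : ℝ → X} {s : Set ℝ}
    (hγ : IsUnitGeodesicOn h γ s) : ContinuousOn (fun t => projParam k σ L (γ t)) s :=
  H.continuousOn_comp_geodesic hγ fun z w => by
    have h1 := H.abs_projParam_sub_le (σ := σ) (L := L) z w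
    have h2 := H.k_nonneg z w
    linarith

/-- The time spent by an `h`-geodesic far from `σ` dominates the sum of the reciprocals of `U`
along its projection to `σ`. -/
theorem sum_le_of_far (H : IsSlowlyConformal k h U δ c) (hL : 0 ≤ L)
    (hσ : IsUnitGeodesicOn k σ (Icc 0 L)) {B D : ℝ}
    (hD : ∀ (γ : ℝ → X) (s t : ℝ) (q : X), s ≤ t → IsUnitGeodesicOn h γ (Icc s t) →
      (∀ u ∈ Icc s t, D ≤ k (γ u) q) → gromovProd k q (γ s) (γ t) ≤ 2 * δ → B / U q ≤ t - s)
    {γ : ℝ → X} {t : ℝ} (m : ℕ) : ∀ s ≤ t, IsUnitGeodesicOn h γ (Icc s t) →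
      (∀ u ∈ Icc s t, D + 2 * δ ≤ k (γ u) (σ (projParam k σ L (γ u)))) →
      projParam k σ L (γ s) + m * (2 * δ + 1) ≤ projParam k σ L (γ t) →
      ∑ i ∈ Finset.range m, B / U (σ (projParam k σ L (γ s) + i * (2 * δ + 1))) ≤ t - s := by
  have hδ := H.one_le_δ
  induction m with
  | zero =>
    intro s hst _ _ _
    simpa using hst
  | succ m ih =>
    intro s hst hγ hfar hm
    push_cast at hm
    have hm0 : 0 ≤ (m : ℝ) * (2 * δ + 1) := by positivity
    obtain ⟨s', hs', hps'⟩ := intermediate_value_Icc hst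
      (H.continuousOn_projParam (σ := σ) (L := L) hγ)
      (⟨by linarith, by linarith⟩ : projParam k σ L (γ s) + (2 * δ + 1) ∈
        Icc (projParam k σ L (γ s)) (projParam k σ L (γ t)))
    change projParam k σ L (γ s') = _ at hps'
    have h1 := ih s' hs'.2 (hγ.mono (Icc_subset_Icc hs'.1 le_rfl))
      (fun u hu => hfar u (Icc_subset_Icc hs'.1 le_rfl hu)) (by rw [hps']; linarith)
    have h2 := hD γ s s' (σ (projParam k σ L (γ s))) hs'.1 (hγ.mono (Icc_subset_Icc le_rfl hs'.2))
      (fun u hu => ?_) (H.gromovProd_le_of_projParam_add_le hL hσ hps'.ge)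
    · rw [Finset.sum_range_succ']
      have h3 : ∀ i : ℕ, projParam k σ L (γ s) + ((i + 1 : ℕ) : ℝ) * (2 * δ + 1) =
          projParam k σ L (γ s') + i * (2 * δ + 1) := fun i => by
        rw [hps']
        push_cast
        ring
      simp only [h3]
      simp only [Nat.cast_zero, zero_mul, add_zero]
      linarith
    · have h3 := hfar u (Icc_subset_Icc le_rfl hs'.2 hu)
      have h4 := H.k_proj_le hL hσ (γ u) (H.projParam_mem hL hσ (γ s))
      linarith

theorem h_le_sum (H : IsSlowlyConformal k h U δ c) (hσ : IsUnitGeodesicOn k σ (Icc 0 L))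
    {C : ℝ} (hC : ∀ x y, k x y ≤ 2 * δ + 1 → h x y ≤ C / U x) {b : ℝ} (hb : b ≤ L) (m : ℕ) :
    ∀ a, 0 ≤ a → a + m * (2 * δ + 1) ≤ b → b ≤ a + (m + 1) * (2 * δ + 1) →
      h (σ a) (σ b) ≤ ∑ i ∈ Finset.range m, C / U (σ (a + i * (2 * δ + 1))) + C / U (σ b) := by
  have hδ := H.one_le_δ
  induction m with
  | zero =>
    intro a ha0 hab hba
    simp only [Nat.cast_zero, zero_mul, add_zero, zero_add, one_mul] at hab hba
    rw [H.h_comm, Finset.range_zero, Finset.sum_empty, zero_add]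
    refine hC _ _ ?_
    rw [hσ b ⟨by linarith, hb⟩ a ⟨ha0, by linarith⟩]
    exact abs_le.2 ⟨by linarith, by linarith⟩
  | succ m ih =>
    intro a ha0 hab hba
    push_cast at hab hba
    have hm0 : 0 ≤ (m : ℝ) * (2 * δ + 1) := by positivity
    have h1 := ih (a + (2 * δ + 1)) (by linarith) (by linarith) (by linarith)
    have h2 := hC (σ a) (σ (a + (2 * δ + 1))) (by
      rw [hσ a ⟨ha0, by linarith⟩ _ ⟨by linarith, by linarith⟩]
      exact abs_le.2 ⟨by linarith, by linarith⟩)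
    have h3 := H.h_triangle (σ a) (σ (a + (2 * δ + 1))) (σ b)
    rw [Finset.sum_range_succ']
    have h4 : ∀ i : ℕ, a + ((i + 1 : ℕ) : ℝ) * (2 * δ + 1) =
        a + (2 * δ + 1) + i * (2 * δ + 1) := fun i => by
      push_cast
      ring
    simp only [h4]
    simp only [Nat.cast_zero, zero_mul, add_zero]
    linarith

theorem exists_k_le_of_h_le (H : IsSlowlyConformal k h U δ c) {A D : ℝ} (hA : 0 ≤ A)
    (hD : 0 ≤ D) {x y q : X} (hxq : k x q ≤ D) (hxy : h x y ≤ A / U q) :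
    3 * k x y ≤ (1 + 3 * D) * (c * A * Real.exp (c * A)) := by
  have hc := H.one_le_c
  have hU := H.one_le_U q
  have hUx := H.one_le_U x
  have h1 := H.k_le x y
  have h2 : U x ≤ (1 + 3 * D) * U q := by
    have := H.U_le q x
    rw [H.k_comm] at this
    nlinarith
  set v := c * (A / U q) with hv
  have hv0 : 0 ≤ v := by positivity
  have h3 : Real.exp (c * h x y) - 1 ≤ v * Real.exp v := by
    have h4 : Real.exp (c * h x y) ≤ Real.exp v := Real.exp_le_exp.2 (by rw [hv]; gcongr)
    have h5 := Real.add_one_le_exp (-v)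
    have h6 : Real.exp v * Real.exp (-v) = 1 := by rw [← Real.exp_add]; simp
    nlinarith [Real.exp_pos v]
  have h7 : v ≤ c * A := by
    rw [hv]
    gcongr
    exact div_le_self hA hU
  calc 3 * k x y ≤ U x * (Real.exp (c * h x y) - 1) := h1
    _ ≤ U x * (v * Real.exp v) := by gcongr
    _ ≤ ((1 + 3 * D) * U q) * (v * Real.exp (c * A)) := by gcongr
    _ = (1 + 3 * D) * (c * A * Real.exp (c * A)) := by
      rw [hv]
      field_simp

theorem exists_forall_stretch (H : IsSlowlyConformal k h U δ c) :
    ∃ D D₁ : ℝ, 0 ≤ D ∧ D ≤ D₁ ∧ ∀ (σ γ : ℝ → X) (L s t : ℝ), 0 ≤ L →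
      IsUnitGeodesicOn k σ (Icc 0 L) → s ≤ t → IsUnitGeodesicOn h γ (Icc s t) →
      (∀ u ∈ Icc s t, D ≤ k (γ u) (σ (projParam k σ L (γ u)))) →
      k (γ s) (σ (projParam k σ L (γ s))) ≤ D → k (γ t) (σ (projParam k σ L (γ t))) ≤ D →
      ∀ u ∈ Icc s t, k (γ u) (σ (projParam k σ L (γ u))) ≤ D₁ := by
  have hδ := H.one_le_δ
  have hc := H.one_le_c
  obtain ⟨C, hC0, hC⟩ := H.exists_h_le (2 * δ + 1)
  obtain ⟨D₀, hD₀, hfar⟩ := H.exists_forall_div_le (B := 2 * C) (by positivity)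
  set D := D₀ + 2 * δ with hDdef
  have hD0 : 0 ≤ D := by positivity
  obtain ⟨C', hC'0, hC'⟩ := H.exists_h_le D
  set A := 4 * (C + C') with hA
  have hA0 : 0 ≤ A := by positivity
  set Q := (1 + 3 * D) * (c * A * Real.exp (c * A)) with hQ
  have hQ0 : 0 ≤ Q := by positivity
  refine ⟨D, D + Q, hD0, by linarith, ?_⟩
  suffices key : ∀ (σ γ : ℝ → X) (L s t : ℝ), 0 ≤ L →
      IsUnitGeodesicOn k σ (Icc 0 L) → s ≤ t → IsUnitGeodesicOn h γ (Icc s t) →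
      (∀ u ∈ Icc s t, D ≤ k (γ u) (σ (projParam k σ L (γ u)))) →
      k (γ s) (σ (projParam k σ L (γ s))) ≤ D → k (γ t) (σ (projParam k σ L (γ t))) ≤ D →
      projParam k σ L (γ s) ≤ projParam k σ L (γ t) →
      ∀ u ∈ Icc s t, k (γ u) (σ (projParam k σ L (γ u))) ≤ D + Q by
    intro σ γ L s t hL hσ hst hγ hk hs ht
    rcases le_total (projParam k σ L (γ s)) (projParam k σ L (γ t)) with hle | hle
    · exact key σ γ L s t hL hσ hst hγ hk hs ht hle
    · have := key (fun a => σ (L - a)) γ L s t hL (isUnitGeodesicOn_reverse hσ) hst hγ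
      simp only [projParam_reverse, sub_sub_cancel, sub_le_sub_iff_left] at this
      exact this hk hs ht hle
  intro σ γ L s t hL hσ hst hγ hk hs ht hle u hu
  set a := projParam k σ L (γ s) with ha
  set b := projParam k σ L (γ t) with hb
  have haL : a ∈ Icc 0 L := H.projParam_mem hL hσ _
  have hbL : b ∈ Icc 0 L := H.projParam_mem hL hσ _
  have hK : 0 < 2 * δ + 1 := by linarith
  set m := ⌊(b - a) / (2 * δ + 1)⌋₊ with hm
  have hm1 : a + m * (2 * δ + 1) ≤ b := by
    have := Nat.floor_le (show 0 ≤ (b - a) / (2 * δ + 1) from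
      div_nonneg (by linarith) hK.le)
    rw [le_div_iff₀ hK] at this
    linarith
  have hm2 : b ≤ a + (m + 1) * (2 * δ + 1) := by
    have := (Nat.lt_floor_add_one ((b - a) / (2 * δ + 1))).le
    rw [div_le_iff₀ hK] at this
    linarith
  have h1 := H.sum_le_of_far hL hσ hfar (γ := γ) (t := t) m s hst hγ hk hm1
  have h2 := H.h_le_sum hσ hC hbL.2 m a haL.1 hm1 hm2
  have h3 : ∑ i ∈ Finset.range m, 2 * C / U (σ (a + i * (2 * δ + 1))) =
      2 * ∑ i ∈ Finset.range m, C / U (σ (a + i * (2 * δ + 1))) := by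
    rw [Finset.mul_sum]
    exact Finset.sum_congr rfl fun i _ => mul_div_assoc _ _ _
  rw [← ha, h3] at h1
  have h4 := hC' (σ a) (γ s) (by rwa [H.k_comm])
  have h5 := hC' (σ b) (γ t) (by rwa [H.k_comm])
  have h6 := H.h_triangle (γ s) (σ a) (γ t)
  have h7 := H.h_triangle (σ a) (σ b) (γ t)
  rw [H.h_comm (γ s) (σ a)] at h6
  have h8 := hγ s ⟨le_rfl, hst⟩ t ⟨hst, le_rfl⟩
  rw [abs_sub_comm, abs_of_nonneg (sub_nonneg.2 hst)] at h8
  have hUa := H.one_le_U (σ a)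
  have hUb := H.one_le_U (σ b)
  have h9 : t - s ≤ 2 * ((C + C') / U (σ a) + (C + C') / U (σ b)) := by
    have : 0 ≤ C / U (σ a) := by positivity
    rw [add_div, add_div]
    linarith
  have hstep : ∀ v ∈ Icc s t, ∀ q, k (γ v) q ≤ D → k (γ v) (σ (projParam k σ L (γ v))) ≤ D →
      t - s ≤ A / U q → k (γ u) (σ (projParam k σ L (γ u))) ≤ D + Q := by
    intro v hv q hvq hvD hA
    have h10 := H.exists_k_le_of_h_le (y := γ u) hA0 hD0 hvq (by
      rw [hγ v hv u hu]
      refine le_trans (abs_le.2 ⟨?_, ?_⟩) hA <;> linarith [hv.1, hv.2, hu.1, hu.2])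
    have h11 := (abs_le.1 (H.abs_k_proj_sub_le hL hσ (γ v) (γ u))).1
    have h12 := H.k_nonneg (γ v) (γ u)
    linarith
  rcases le_total (U (σ a)) (U (σ b)) with hab | hab
  · refine hstep s ⟨le_rfl, hst⟩ (σ a) hs hs (h9.trans ?_)
    have : (C + C') / U (σ b) ≤ (C + C') / U (σ a) := by gcongr
    rw [hA, mul_div_assoc]
    linarith
  · refine hstep t ⟨hst, le_rfl⟩ (σ b) ht ht (h9.trans ?_)
    have : (C + C') / U (σ a) ≤ (C + C') / U (σ b) := by gcongr
    rw [hA, mul_div_assoc]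
    linarith

theorem exists_last_le {φ : ℝ → ℝ} {a b D : ℝ} (hab : a ≤ b) (hφ : ContinuousOn φ (Icc a b))
    (ha : φ a ≤ D) (hb : D ≤ φ b) :
    ∃ s ∈ Icc a b, φ s ≤ D ∧ ∀ u ∈ Icc s b, D ≤ φ u := by
  have hcomp : IsCompact (Icc a b ∩ φ ⁻¹' Iic D) :=
    isCompact_Icc.of_isClosed_subset (hφ.preimage_isClosed_of_isClosed isClosed_Icc isClosed_Iic)
      inter_subset_left
  obtain ⟨s, ⟨hs, hsD⟩, hmax⟩ := hcomp.exists_isGreatest ⟨a, ⟨le_rfl, hab⟩, ha⟩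
  have hgt : ∀ u ∈ Icc a b, s < u → D < φ u := fun u hu hsu => by
    by_contra! hle
    exact absurd (hmax ⟨hu, hle⟩) (not_le.2 hsu)
  have hsD' : D ≤ φ s := by
    obtain ⟨v, hv, hvD⟩ := intermediate_value_Icc hs.2 (hφ.mono (Icc_subset_Icc hs.1 le_rfl))
      ⟨hsD, hb⟩
    have hvs := hmax ⟨⟨hs.1.trans hv.1, hv.2⟩, hvD.le⟩
    rw [← le_antisymm hvs hv.1, hvD]
  refine ⟨s, hs, hsD, fun u hu => ?_⟩
  rcases hu.1.eq_or_lt with rfl | hlt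
  · exact hsD'
  · exact (hgt u ⟨hs.1.trans hu.1, hu.2⟩ hlt).le

theorem exists_first_le {φ : ℝ → ℝ} {a b D : ℝ} (hab : a ≤ b) (hφ : ContinuousOn φ (Icc a b))
    (ha : D ≤ φ a) (hb : φ b ≤ D) :
    ∃ s ∈ Icc a b, φ s ≤ D ∧ ∀ u ∈ Icc a s, D ≤ φ u := by
  obtain ⟨s, hs, hsD, hmax⟩ := exists_last_le (φ := fun u => φ (-u)) (D := D) (neg_le_neg hab)
    (hφ.comp continuousOn_neg fun u hu => ⟨by linarith [hu.2], by linarith [hu.1]⟩)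
    (by simpa using hb) (by simpa using ha)
  refine ⟨-s, ⟨by linarith [hs.2], by linarith [hs.1]⟩, hsD, fun u hu => ?_⟩
  simpa using hmax (-u) ⟨by linarith [hu.2], by linarith [hu.1]⟩

/-- Stability of geodesics: `h`-geodesics and `k`-geodesics with common endpoints stay at
uniformly bounded `k`-distance from each other. -/
theorem exists_forall_geodesic_close (H : IsSlowlyConformal k h U δ c) :
    ∃ D : ℝ, ∀ (σ γ : ℝ → X) (L T : ℝ), 0 ≤ L → 0 ≤ T → IsUnitGeodesicOn k σ (Icc 0 L) →
      IsUnitGeodesicOn h γ (Icc 0 T) → γ 0 = σ 0 → γ T = σ L →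
      (∀ t ∈ Icc 0 T, ∃ a ∈ Icc 0 L, k (γ t) (σ a) ≤ D) ∧
        ∀ a ∈ Icc 0 L, ∃ t ∈ Icc 0 T, k (γ t) (σ a) ≤ D := by
  obtain ⟨D, D₁, hD0, hDD₁, hD⟩ := H.exists_forall_stretch
  refine ⟨D₁, fun σ γ L T hL hT hσ hγ h0 hT' => ?_⟩
  have hk0L := (k_ends hσ (⟨le_rfl, hL⟩ : (0 : ℝ) ∈ Icc 0 L)).2
  have hp0 : projParam k σ L (γ 0) = 0 := by
    unfold projParam
    rw [h0, H.k_self, hk0L]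
    ring
  have hpT : projParam k σ L (γ T) = L := by
    unfold projParam
    rw [hT', H.k_self, H.k_comm, hk0L]
    ring
  have hclose : ∀ t ∈ Icc 0 T, k (γ t) (σ (projParam k σ L (γ t))) ≤ D₁ := by
    intro t ht
    rcases le_total (k (γ t) (σ (projParam k σ L (γ t)))) D with hle | hle
    · exact hle.trans hDD₁
    have hcont : ContinuousOn (fun t => k (γ t) (σ (projParam k σ L (γ t)))) (Icc 0 T) :=
      H.continuousOn_comp_geodesic (F := fun z => k z (σ (projParam k σ L z))) hγ
        (H.abs_k_proj_sub_le hL hσ)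
    obtain ⟨s₁, hs₁, hs₁D, hs₁'⟩ := exists_last_le ht.1
      (hcont.mono (Icc_subset_Icc le_rfl ht.2)) (D := D)
      (by simp only [hp0]; rw [h0, H.k_self]; exact hD0) hle
    obtain ⟨s₂, hs₂, hs₂D, hs₂'⟩ := exists_first_le ht.2
      (hcont.mono (Icc_subset_Icc ht.1 le_rfl)) (D := D) hle
      (by simp only [hpT]; rw [hT', H.k_self]; exact hD0)
    refine hD σ γ L s₁ s₂ hL hσ (hs₁.2.trans hs₂.1) (hγ.mono (Icc_subset_Icc hs₁.1 hs₂.2))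
      (fun u hu => ?_) hs₁D hs₂D t ⟨hs₁.2, hs₂.1⟩
    rcases le_total u t with hut | hut
    · exact hs₁' u ⟨hu.1, hut⟩
    · exact hs₂' u ⟨hut, hu.2⟩
  refine ⟨fun t ht => ⟨_, H.projParam_mem hL hσ _, hclose t ht⟩, fun a ha => ?_⟩
  obtain ⟨t, ht, rfl⟩ := intermediate_value_Icc hT
    (H.continuousOn_projParam (σ := σ) (L := L) hγ) (by rw [hp0, hpT]; exact ha)
  exact ⟨t, ht, hclose t ht⟩

end IsSlowlyConformal

end Stability

section Visibility

variable {Ω : Set ℂ} {x y z : ℂ}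

theorem qhDist_self (hO : IsOpen Ω) (hne : Ωᶜ.Nonempty) (hx : x ∈ Ω) : qhDist Ω x x = 0 := by
  rw [qhDist_eq_weightedDist]
  exact weightedDist_self (isConformalWeight_inv_infDist hO hne).nonneg hx

theorem qhDist_comm : qhDist Ω x y = qhDist Ω y x := by
  rw [qhDist_eq_weightedDist, weightedDist_comm, ← qhDist_eq_weightedDist]

theorem qhDist_triangle (hO : IsOpen Ω) (hC : IsPreconnected Ω) (hne : Ωᶜ.Nonempty)
    (hx : x ∈ Ω) (hy : y ∈ Ω) (hz : z ∈ Ω) :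
    qhDist Ω x z ≤ qhDist Ω x y + qhDist Ω y z := by
  simp only [qhDist_eq_weightedDist]
  exact weightedDist_triangle (isConformalWeight_inv_infDist hO hne) hO hC hx hy hz

/-- The quasihyperbolic and hyperbolic distances of a Gromov hyperbolic plane domain are related
through the Beardon–Pommerenke factor. -/
theorem exists_isSlowlyConformal (hO : IsOpen Ω) (hC : IsPreconnected Ω)
    (hH : IsHyperbolicDomain Ω) (hG : QHGromovHyperbolic Ω) :
    ∃ δ : ℝ, IsSlowlyConformal (fun x y : Ω => qhDist Ω x y) (fun x y : Ω => hypDist Ω x y)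
      (fun x : Ω => bpFactor Ω x) δ 60000 := by
  obtain ⟨δ, -, hδ⟩ := hG
  have hne := hH.nonempty_compl
  refine ⟨max δ 1, fun x => qhDist_self hO hne x.2, fun x y => qhDist_nonneg hO hne,
    fun x y => qhDist_comm, fun x y z => qhDist_triangle hO hC hne x.2 y.2 z.2,
    fun x y => weightedDist_comm,
    fun x y z => weightedDist_triangle (isConformalWeight_hypDensity hO hH) hO hC x.2 y.2 z.2,
    fun x => one_le_bpFactor hO x.2, fun x y => bpFactor_le_add hO hC hH x.2 y.2, by norm_num,
    fun x y => log_one_add_qhDist_le hO hC hH x.2 y.2, fun D => ?_, le_max_right _ _,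
    fun o x y z => ?_⟩
  · have hD : 0 < max D 0 + 1 := by positivity
    refine ⟨2 * (1 + 3 * (max D 0 + 1)) * (max D 0 + 1), by positivity, fun x y hxy => ?_⟩
    exact hypDist_le_of_qhDist_lt hO hC hH x.2 y.2
      (lt_of_le_of_lt (hxy.trans (le_max_left _ _)) (lt_add_one _))
  · exact (sub_le_sub_left (le_max_left δ 1) _).trans (hδ o o.2 x x.2 y y.2 z z.2)

/-- Geodesic stability: in a Gromov hyperbolic plane domain, quasihyperbolic and hyperbolic
geodesics with common endpoints lie within bounded quasihyperbolic distance of each other. -/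
theorem exists_forall_qhGeodesic_hypGeodesic_close (hO : IsOpen Ω) (hC : IsPreconnected Ω)
    (hH : IsHyperbolicDomain Ω) (hG : QHGromovHyperbolic Ω) :
    ∃ D : ℝ, ∀ (σ γ : ℝ → ℂ) (L T : ℝ), 0 ≤ L → 0 ≤ T → IsQHGeodesicOn Ω σ (Icc 0 L) →
      IsHypGeodesicOn Ω γ (Icc 0 T) → γ 0 = σ 0 → γ T = σ L →
      (∀ t ∈ Icc 0 T, ∃ a ∈ Icc 0 L, qhDist Ω (γ t) (σ a) ≤ D) ∧
        ∀ a ∈ Icc 0 L, ∃ t ∈ Icc 0 T, qhDist Ω (γ t) (σ a) ≤ D := by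
  obtain ⟨δ, H⟩ := exists_isSlowlyConformal hO hC hH hG
  obtain ⟨D, hD⟩ := H.exists_forall_geodesic_close
  refine ⟨D, fun σ γ L T hL hT hσ hγ h0 hT' => ?_⟩
  let σ' : ℝ → Ω := fun t => ⟨σ (projIcc 0 L hL t), hσ.1 _ (projIcc 0 L hL t).2⟩
  let γ' : ℝ → Ω := fun t => ⟨γ (projIcc 0 T hT t), hγ.1 _ (projIcc 0 T hT t).2⟩
  have hσ' : ∀ t ∈ Icc 0 L, (σ' t : ℂ) = σ t := fun t ht => by
    simp only [σ', projIcc_of_mem hL ht]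
  have hγ' : ∀ t ∈ Icc 0 T, (γ' t : ℂ) = γ t := fun t ht => by
    simp only [γ', projIcc_of_mem hT ht]
  obtain ⟨h1, h2⟩ := hD σ' γ' L T hL hT
    (fun a ha b hb => by simp only [hσ' a ha, hσ' b hb]; exact hσ.2 a ha b hb)
    (fun a ha b hb => by simp only [hγ' a ha, hγ' b hb]; exact hγ.2 a ha b hb)
    (Subtype.ext (by rw [hσ' 0 ⟨le_rfl, hL⟩, hγ' 0 ⟨le_rfl, hT⟩, h0]))
    (Subtype.ext (by rw [hσ' L ⟨hL, le_rfl⟩, hγ' T ⟨hT, le_rfl⟩, hT']))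
  constructor
  · intro t ht
    obtain ⟨a, ha, h⟩ := h1 t ht
    simp only [hσ' a ha, hγ' t ht] at h
    exact ⟨a, ha, h⟩
  · intro a ha
    obtain ⟨t, ht, h⟩ := h2 a ha
    simp only [hσ' a ha, hγ' t ht] at h
    exact ⟨t, ht, h⟩

theorem exists_isQHGeodesicOn (hO : IsOpen Ω) (hC : IsPreconnected Ω)
    (hB : Bornology.IsBounded Ω) (hne : Ωᶜ.Nonempty) (hx : x ∈ Ω) (hy : y ∈ Ω) (hxy : x ≠ y) :
    ∃ (σ : ℝ → ℂ) (L : ℝ), 0 ≤ L ∧ IsQHGeodesicOn Ω σ (Icc 0 L) ∧ σ 0 = x ∧ σ L = y := by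
  have hpos := qhDist_pos hO hC hne hx hy hxy
  have hδ := infDist_compl_pos hO hne hx
  have hball : ∀ z ∈ Ω, qhDist Ω x z ≤ qhDist Ω x y →
      z ∈ {z ∈ closure Ω | infDist x Ωᶜ * Real.exp (-qhDist Ω x y) ≤ infDist z Ωᶜ} :=
    fun z hz h => ⟨subset_closure hz, infDist_compl_mul_exp_le hO hC hne hx hz h⟩
  have hK := isCompact_le_infDist_compl hB (infDist x Ωᶜ * Real.exp (-qhDist Ω x y))
  have hKΩ := le_infDist_compl_subset (Ω := Ω)
    (mul_pos hδ (Real.exp_pos (-qhDist Ω x y)))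
  simp only [qhDist_eq_weightedDist] at hpos hball hK hKΩ
  obtain ⟨g, hg0, hgT, hgΩ, hg⟩ := exists_weightedDist_geodesic
    (isConformalWeight_inv_infDist hO hne) hO hC hx hy hpos hK hKΩ hball
  refine ⟨g, _, hpos.le, ⟨hgΩ, ?_⟩, hg0, hgT⟩
  simpa only [qhDist_eq_weightedDist] using hg

theorem exists_isHypGeodesicOn (hO : IsOpen Ω) (hC : IsPreconnected Ω)
    (hB : Bornology.IsBounded Ω) (hH : IsHyperbolicDomain Ω) (hx : x ∈ Ω) (hy : y ∈ Ω)
    (hxy : x ≠ y) :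
    ∃ (γ : ℝ → ℂ) (T : ℝ), 0 ≤ T ∧ IsHypGeodesicOn Ω γ (Icc 0 T) ∧ γ 0 = x ∧ γ T = y := by
  have hne := hH.nonempty_compl
  have hδ := infDist_compl_pos hO hne hx
  have hU := one_le_bpFactor hO hx
  have hpos : 0 < hypDist Ω x y := by
    have h1 := log_one_add_qhDist_le hO hC hH hx hy
    have h2 := qhDist_pos hO hC hne hx hy hxy
    have h3 : 0 < Real.log (1 + 3 * qhDist Ω x y / bpFactor Ω x) :=
      Real.log_pos (lt_add_of_pos_right _ (by positivity))
    linarith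
  set D : ℝ := bpFactor Ω x * Real.exp (60000 * hypDist Ω x y) with hD
  have hball : ∀ z ∈ Ω, hypDist Ω x z ≤ hypDist Ω x y →
      z ∈ {z ∈ closure Ω | infDist x Ωᶜ * Real.exp (-D) ≤ infDist z Ωᶜ} := by
    refine fun z hz h => ⟨subset_closure hz, infDist_compl_mul_exp_le hO hC hne hx hz ?_⟩
    have h1 := (log_one_add_qhDist_le hO hC hH hx hz).trans
      (mul_le_mul_of_nonneg_left h (by norm_num))
    have h2 : 0 ≤ qhDist Ω x z := qhDist_nonneg hO hne
    rw [Real.log_le_iff_le_exp (by positivity)] at h1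
    have h3 : 3 * qhDist Ω x z / bpFactor Ω x ≤ Real.exp (60000 * hypDist Ω x y) := by linarith
    rw [div_le_iff₀ (by linarith), mul_comm _ (bpFactor Ω x)] at h3
    linarith
  obtain ⟨g, hg0, hgT, hgΩ, hg⟩ := exists_weightedDist_geodesic
    (isConformalWeight_hypDensity hO hH) hO hC hx hy hpos (isCompact_le_infDist_compl hB _)
    (le_infDist_compl_subset (mul_pos hδ (Real.exp_pos (-D)))) hball
  exact ⟨g, _, hpos.le, ⟨hgΩ, hg⟩, hg0, hgT⟩

/-- In a bounded domain, closed quasihyperbolic neighbourhoods of compact sets are relatively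
compact. -/
theorem exists_isCompact_of_qhDist_le (hO : IsOpen Ω) (hC : IsPreconnected Ω)
    (hB : Bornology.IsBounded Ω) (hne : Ωᶜ.Nonempty) {K : Set ℂ} (hK : IsCompact K) (hKΩ : K ⊆ Ω)
    (D : ℝ) :
    ∃ K' : Set ℂ, IsCompact K' ∧ K' ⊆ Ω ∧ ∀ x ∈ K, ∀ y ∈ Ω, qhDist Ω x y ≤ D → y ∈ K' := by
  obtain ⟨M, hM⟩ := (isConformalWeight_inv_infDist hO hne).bounded K hKΩ hK
  have hM0 : 0 < max M 1 := by positivity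
  refine ⟨_, isCompact_le_infDist_compl hB (1 / max M 1 * Real.exp (-D)),
    le_infDist_compl_subset (by positivity), fun x hx y hy hxy => ⟨subset_closure hy, ?_⟩⟩
  refine le_trans ?_ (infDist_compl_mul_exp_le hO hC hne (hKΩ hx) hy hxy)
  gcongr
  rw [one_div_le hM0 (infDist_compl_pos hO hne (hKΩ hx))]
  exact (hM x hx).trans (le_max_left _ _)

theorem ne_of_mem_of_closure_inter_eq_empty {U V : Set ℂ} (h : closure U ∩ closure V = ∅)
    (hx : x ∈ U) (hy : y ∈ V) : x ≠ y := by
  rintro rfl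
  exact (h ▸ ⟨subset_closure hx, subset_closure hy⟩ : x ∈ (∅ : Set ℂ))

end Visibility

/-- For a bounded hyperbolic plane domain `Ω` which is Gromov hyperbolic
(equivalently with respect to the hyperbolic or the quasihyperbolic metric, by
Buckley–Herron), H-visibility and QH-visibility are equivalent. -/
theorem statement9 (Ω : Set ℂ)
    (hOpen : IsOpen Ω) (hConn : IsConnected Ω) (hBdd : Bornology.IsBounded Ω)
    (hHyp : IsHyperbolicDomain Ω) (hGromov : QHGromovHyperbolic Ω) :
    HVisibilityDomain Ω ↔ QHVisibilityDomain Ω := by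
  have hC := hConn.isPreconnected
  have hne := hHyp.nonempty_compl
  obtain ⟨D, hD⟩ := exists_forall_qhGeodesic_hypGeodesic_close hOpen hC hHyp hGromov
  constructor
  · intro hvis p hp q hq hpq
    obtain ⟨U, V, hU, hV, hpU, hqV, hUV, K, hK, hKΩ, hmeet⟩ := hvis p hp q hq hpq
    obtain ⟨K', hK', hK'Ω, hnear⟩ := exists_isCompact_of_qhDist_le hOpen hC hBdd hne hK hKΩ D
    refine ⟨U, V, hU, hV, hpU, hqV, hUV, K', hK', hK'Ω, fun σ L hL hσ h0 h1 => ?_⟩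
    obtain ⟨γ, T, hT, hγ, hγ0, hγT⟩ := exists_isHypGeodesicOn hOpen hC hBdd hHyp
      (hσ.1 0 ⟨le_rfl, hL⟩) (hσ.1 L ⟨hL, le_rfl⟩)
      (ne_of_mem_of_closure_inter_eq_empty hUV h0 h1)
    obtain ⟨t, ht, htK⟩ := hmeet γ T hT hγ (hγ0 ▸ h0) (hγT ▸ h1)
    obtain ⟨a, ha, hta⟩ := (hD σ γ L T hL hT hσ hγ hγ0 hγT).1 t ht
    exact ⟨a, ha, hnear _ htK _ (hσ.1 a ha) hta⟩
  · intro hvis p hp q hq hpq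
    obtain ⟨U, V, hU, hV, hpU, hqV, hUV, K, hK, hKΩ, hmeet⟩ := hvis p hp q hq hpq
    obtain ⟨K', hK', hK'Ω, hnear⟩ := exists_isCompact_of_qhDist_le hOpen hC hBdd hne hK hKΩ D
    refine ⟨U, V, hU, hV, hpU, hqV, hUV, K', hK', hK'Ω, fun γ T hT hγ h0 h1 => ?_⟩
    obtain ⟨σ, L, hL, hσ, hσ0, hσL⟩ := exists_isQHGeodesicOn hOpen hC hBdd hne
      (hγ.1 0 ⟨le_rfl, hT⟩) (hγ.1 T ⟨hT, le_rfl⟩)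
      (ne_of_mem_of_closure_inter_eq_empty hUV h0 h1)
    obtain ⟨a, ha, haK⟩ := hmeet σ L hL hσ (hσ0 ▸ h0) (hσL ▸ h1)
    obtain ⟨t, ht, hta⟩ := (hD σ γ L T hL hT hσ hγ hσ0.symm hσL.symm).2 a ha
    exact ⟨t, ht, hnear _ haK _ (hγ.1 t ht) (qhDist_comm.trans_le hta)⟩

end
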